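/- arXiv:1707.03174 — 4 statements merged into one kernel-verified Lean document; each statement's English description precedes it below -/
import Mathlib

section
/- Let m,n,p ≥ 3 and, over the three-letter alphabet {a,b,c}, let K₁ = L(X_m(a,b,−;{c})), K₂ = L(X_n(a,c,−;{b})), K₃ = L(X_p(a,−,b;{c})). Then: sc((K₁ ∩ K₂)·K₃) = mn·2^p − 2^{p−1}; sc((K₁ ∪ K₂)·K₃) = mn·2^p − (m+n−1)·2^{p−1}; and sc((K₁ ⊕ K₂)·K₃) = mn·2^p − (m+n−2)·2^{p−1}, where ⊕ denotes symmetric difference. -/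
/-- The cyclic permutation `i ↦ i+1 mod n` on `{0,…,n−1}`. -/
def cyc {n : ℕ} (i : Fin n) : Fin n := ⟨(i.val + 1) % n, Nat.mod_lt _ i.pos⟩

/-- The transposition exchanging `0` and `1` and fixing all other elements of `{0,…,n−1}`. -/
def transp {n : ℕ} (i : Fin n) : Fin n :=
  if i.val = 0 then ⟨1 % n, Nat.mod_lt _ i.pos⟩
  else if i.val = 1 then ⟨0, i.pos⟩ else i

/-- The contraction sending `1` to `0` and fixing all other elements of `{0,…,n−1}`. -/
def contr {n : ℕ} (i : Fin n) : Fin n := if i.val = 1 then ⟨0, i.pos⟩ else i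

/-- A Brzozowski-type complete DFA: state set `{0,…,n−1}`, initial state `0`,
unique final state `n−1`, where each letter `x` acts as the transformation `f x`. -/
def brzDFA {α : Type} (n : ℕ) (hn : 0 < n) (f : α → Fin n → Fin n) : DFA α (Fin n) where
  step q x := f x q
  start := ⟨0, hn⟩
  accept := {⟨n - 1, Nat.sub_lt hn Nat.one_pos⟩}

/-- The state complexity of a language: the least number of states of a complete
DFA recognizing it. -/
noncomputable def sc {α : Type} (L : Language α) : ℕ :=
  sInf {n | ∃ M : DFA α (Fin n), M.accepts = L}

/-- The three-letter alphabet `{a,b,c}`. -/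
inductive ABC | a | b | c

/-- `X_m(a,b,−;{c})`: `a` the cycle, `b` the transposition, `c` the identity. -/
def YA (m : ℕ) (hm : 0 < m) : DFA ABC (Fin m) :=
  brzDFA m hm (fun x q => match x with | ABC.a => cyc q | ABC.b => transp q | ABC.c => q)

/-- `X_n(a,c,−;{b})`: `a` the cycle, `c` the transposition, `b` the identity. -/
def YB (n : ℕ) (hn : 0 < n) : DFA ABC (Fin n) :=
  brzDFA n hn (fun x q => match x with | ABC.a => cyc q | ABC.b => q | ABC.c => transp q)

/-- `X_p(a,−,b;{c})`: `a` the cycle, `b` the contraction, `c` the identity. -/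
def YC (p : ℕ) (hp : 0 < p) : DFA ABC (Fin p) :=
  brzDFA p hp (fun x q => match x with | ABC.a => cyc q | ABC.b => contr q | ABC.c => q)

namespace BrzozowskiConcat

open Function

section StateComplexity

variable {α σ τ : Type}

theorem acceptsFrom_evalFrom_eq (M : DFA α σ) {s t : σ} (h : M.acceptsFrom s = M.acceptsFrom t)
    (u : List α) : M.acceptsFrom (M.evalFrom s u) = M.acceptsFrom (M.evalFrom t u) := by
  ext w
  rw [DFA.mem_acceptsFrom, DFA.mem_acceptsFrom, ← DFA.evalFrom_of_append,
    ← DFA.evalFrom_of_append, ← DFA.mem_acceptsFrom, h, DFA.mem_acceptsFrom]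

/-- The state complexity of the language of a DFA is the number of its reachable states, provided
these are pairwise distinguishable. -/
theorem sc_accepts_eq_ncard [Finite σ] (M : DFA α σ) (V : Set σ)
    (hreach : ∀ s, s ∈ V ↔ ∃ w, M.eval w = s)
    (hdist : Set.InjOn M.acceptsFrom V) :
    sc M.accepts = V.ncard := by
  have hstep : ∀ s ∈ V, ∀ x, M.step s x ∈ V := by
    intro s hs x
    obtain ⟨w, rfl⟩ := (hreach s).1 hs
    exact (hreach _).2 ⟨w ++ [x], by simp⟩
  have hstart : M.start ∈ V := (hreach _).2 ⟨[], rfl⟩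
  let N : DFA α V :=
    { step := fun s x => ⟨M.step s.1 x, hstep s.1 s.2 x⟩
      start := ⟨M.start, hstart⟩
      accept := {s | s.1 ∈ M.accept} }
  have hN : ∀ w, (N.eval w).1 = M.eval w := by
    intro w
    induction w using List.reverseRecOn with
    | nil => rfl
    | append_singleton w x ih =>
      rw [DFA.eval_append_singleton, DFA.eval_append_singleton, ← ih]
  have hNacc : N.accepts = M.accepts := by
    ext w
    rw [DFA.mem_accepts, DFA.mem_accepts, ← hN w]
    rfl
  rw [← Nat.card_coe_set_eq]
  have hmem : Nat.card V ∈ {n | ∃ M' : DFA α (Fin n), M'.accepts = M.accepts} :=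
    ⟨DFA.reindex (Finite.equivFin V) N, by rw [DFA.accepts_reindex, hNacc]⟩
  refine le_antisymm (Nat.sInf_le hmem) (le_csInf ⟨_, hmem⟩ ?_)
  rintro n ⟨M', hM'⟩
  choose w hw using fun s : V => (hreach s.1).1 s.2
  have hinj : Injective fun s : V => M'.eval (w s) := by
    intro s t hst
    refine Subtype.ext (hdist s.2 t.2 (Language.ext fun v => ?_))
    have key : ∀ r : V, M.evalFrom r v ∈ M.accept ↔
        M'.evalFrom (M'.eval (w r)) v ∈ M'.accept := by
      intro r
      have h1 : w r ++ v ∈ M.accepts ↔ w r ++ v ∈ M'.accepts := by rw [hM']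
      rw [DFA.mem_accepts, DFA.mem_accepts] at h1
      simp only [DFA.eval, DFA.evalFrom_of_append] at h1
      rw [← hw r]
      exact h1
    rw [DFA.mem_acceptsFrom, DFA.mem_acceptsFrom, key s, key t]
    exact iff_of_eq (congrArg (fun q => M'.evalFrom q v ∈ M'.accept) hst)
  simpa using Nat.card_le_card_of_injective _ hinj

/-- The product DFA that accepts according to the connective `φ`. -/
def prodDFA (φ : Prop → Prop → Prop) (M : DFA α σ) (N : DFA α τ) : DFA α (σ × τ) where
  step q x := (M.step q.1 x, N.step q.2 x)
  start := (M.start, N.start)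
  accept := {q | φ (q.1 ∈ M.accept) (q.2 ∈ N.accept)}

theorem prodDFA_eval (φ : Prop → Prop → Prop) (M : DFA α σ) (N : DFA α τ) (w : List α) :
    (prodDFA φ M N).eval w = (M.eval w, N.eval w) := by
  induction w using List.reverseRecOn with
  | nil => rfl
  | append_singleton w x ih =>
    simp only [DFA.eval_append_singleton, ih]
    rfl

theorem mem_prodDFA_accepts (φ : Prop → Prop → Prop) (M : DFA α σ) (N : DFA α τ) (w : List α) :
    w ∈ (prodDFA φ M N).accepts ↔ φ (w ∈ M.accepts) (w ∈ N.accepts) := by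
  rw [DFA.mem_accepts, prodDFA_eval]
  rfl

/-- The subset-construction DFA for the concatenation of the languages of two DFAs. -/
def concatDFA (M : DFA α σ) (N : DFA α τ) : DFA α (σ × Set τ) where
  step q x := (M.step q.1 x,
    (fun t => N.step t x) '' q.2 ∪ {t | t = N.start ∧ M.step q.1 x ∈ M.accept})
  start := (M.start, {t | t = N.start ∧ M.start ∈ M.accept})
  accept := {q | ∃ t ∈ q.2, t ∈ N.accept}

theorem concatDFA_evalFrom_fst (M : DFA α σ) (N : DFA α τ) (s : σ × Set τ) (w : List α) :
    ((concatDFA M N).evalFrom s w).1 = M.evalFrom s.1 w := by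
  induction w using List.reverseRecOn with
  | nil => rfl
  | append_singleton w x ih =>
    simp only [DFA.evalFrom_append_singleton, ← ih]
    rfl

theorem concatDFA_eval_fst (M : DFA α σ) (N : DFA α τ) (w : List α) :
    ((concatDFA M N).eval w).1 = M.eval w :=
  concatDFA_evalFrom_fst M N _ w

theorem mem_concatDFA_eval_snd (M : DFA α σ) (N : DFA α τ) (w : List α) (t : τ) :
    t ∈ ((concatDFA M N).eval w).2 ↔
      ∃ u v, u ++ v = w ∧ u ∈ M.accepts ∧ N.eval v = t := by
  induction w using List.reverseRecOn generalizing t with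
  | nil =>
    constructor
    · rintro ⟨rfl, h⟩
      exact ⟨[], [], rfl, h, rfl⟩
    · rintro ⟨u, v, huv, hu, rfl⟩
      obtain ⟨rfl, rfl⟩ := List.append_eq_nil_iff.1 huv
      exact ⟨rfl, hu⟩
  | append_singleton w x ih =>
    rw [DFA.eval_append_singleton]
    constructor
    · rintro (⟨s, hs, rfl⟩ | ⟨rfl, h⟩)
      · obtain ⟨u, v, rfl, hu, rfl⟩ := (ih s).1 hs
        exact ⟨u, v ++ [x], by simp, hu, by simp⟩
      · refine ⟨w ++ [x], [], by simp, ?_, rfl⟩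
        rw [concatDFA_eval_fst] at h
        rw [DFA.mem_accepts, DFA.eval_append_singleton]
        exact h
    · rintro ⟨u, v, huv, hu, rfl⟩
      rcases List.eq_nil_or_concat v with rfl | ⟨v, y, rfl⟩
      · refine Or.inr ⟨rfl, ?_⟩
        rw [concatDFA_eval_fst, ← DFA.eval_append_singleton, ← huv, List.append_nil]
        exact hu
      · rw [List.concat_eq_append, ← List.append_assoc] at huv
        obtain ⟨rfl, hxy⟩ := List.append_inj' huv rfl
        obtain rfl : y = x := by simpa using hxy
        exact Or.inl ⟨N.eval v, (ih _).2 ⟨u, v, rfl, hu, rfl⟩, by simp⟩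

theorem concatDFA_accepts (M : DFA α σ) (N : DFA α τ) :
    (concatDFA M N).accepts = M.accepts * N.accepts := by
  ext w
  rw [DFA.mem_accepts, Language.mem_mul]
  constructor
  · rintro ⟨t, ht, hacc⟩
    obtain ⟨u, v, rfl, hu, rfl⟩ := (mem_concatDFA_eval_snd M N w t).1 ht
    exact ⟨u, hu, v, hacc, rfl⟩
  · rintro ⟨u, hu, v, hv, rfl⟩
    exact ⟨_, (mem_concatDFA_eval_snd M N _ _).2 ⟨u, v, rfl, hu, rfl⟩, hv⟩

end StateComplexity

section Letters

variable {n : ℕ}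

theorem cyc_iterate_val (d : ℕ) (y : Fin n) : (cyc^[d] y).val = (y.val + d) % n := by
  induction d with
  | zero => simp [Nat.mod_eq_of_lt y.isLt]
  | succ d ih => simp [iterate_succ_apply', cyc, ih, Nat.add_assoc]

theorem cyc_injective : Injective (cyc (n := n)) := by
  intro x y h
  have h' : (x.val + 1) ≡ (y.val + 1) [MOD n] := congrArg Fin.val h
  exact Fin.ext ((Nat.ModEq.add_right_cancel' 1 h').eq_of_lt_of_lt x.isLt y.isLt)

theorem cyc_bijective : Bijective (cyc (n := n)) := Finite.injective_iff_bijective.1 cyc_injective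

theorem cyc_val_of_lt {x : Fin n} (h : x.val + 1 < n) : (cyc x).val = x.val + 1 :=
  Nat.mod_eq_of_lt h

theorem cyc_val_of_eq {x : Fin n} (h : x.val + 1 = n) : (cyc x).val = 0 := by
  simp [cyc, h]

theorem cyc_ne_zero {x : Fin n} (h : x.val + 1 < n) : cyc x ≠ ⟨0, by omega⟩ := by
  intro h0
  have := cyc_val_of_lt h
  rw [h0] at this
  simp at this

theorem transp_val (hn : 3 ≤ n) (x : Fin n) :
    (transp x).val = if x.val = 0 then 1 else if x.val = 1 then 0 else x.val := by
  unfold transp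
  split_ifs
  · exact Nat.mod_eq_of_lt (by omega)
  · rfl
  · rfl

theorem transp_eq_swap (hn : 3 ≤ n) (x : Fin n) :
    transp x = Equiv.swap (⟨0, by omega⟩ : Fin n) ⟨1, by omega⟩ x := by
  apply Fin.ext
  rw [transp_val hn, Equiv.swap_apply_def]
  simp only [Fin.ext_iff]
  split_ifs <;> rfl

theorem transp_val_eq_last_iff (hn : 3 ≤ n) (x : Fin n) :
    (transp x).val = n - 1 ↔ x.val = n - 1 := by
  rw [transp_val hn]
  split_ifs <;> omega

theorem contr_image_of_notMem {S : Set (Fin n)} (hn : 3 ≤ n) (h : (⟨1, by omega⟩ : Fin n) ∉ S) :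
    contr '' S = S := by
  have hx : ∀ x ∈ S, contr x = x := by
    intro x hx
    refine if_neg fun h1 => h ?_
    rwa [← (Fin.ext h1 : x = ⟨1, by omega⟩)]
  rw [Set.image_congr hx, Set.image_id']

theorem one_notMem_contr_image (hn : 3 ≤ n) (S : Set (Fin n)) :
    (⟨1, by omega⟩ : Fin n) ∉ contr '' S := by
  rintro ⟨x, -, hx⟩
  unfold contr at hx
  split_ifs at hx with h
  · simp [Fin.ext_iff] at hx
  · exact h (congrArg Fin.val hx)

end Letters

/-- Every pair `(q, S)` in which `0 ∈ S` whenever `q` is final can be reached. -/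
theorem reach_of_valid {m n p : ℕ} (hm : 3 ≤ m) (hn : 3 ≤ n) (hp : 3 ≤ p)
    (φ : Prop → Prop → Prop) (hφ0 : ¬φ False False) (hφ1 : φ True True ∨ φ True False)
    (R : ℕ → ℕ → Set (Fin p) → Prop) (h0 : R 0 0 ∅)
    (ha : ∀ i j S, i < m → j < n → R i j S → R ((i + 1) % m) ((j + 1) % n)
      (cyc '' S ∪
        {t | t = ⟨0, Nat.zero_lt_of_lt hp⟩ ∧ φ ((i + 1) % m = m - 1) ((j + 1) % n = n - 1)}))
    (hb : ∀ j S, j < n → R 1 j S → R 0 j (contr '' S))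
    (hc : ∀ i S, i < m → R i 1 S → R i 0 S) (k : ℕ) :
    ∀ S : Set (Fin p), S.ncard = k → ∀ i j, i < m → j < n →
      (φ (i = m - 1) (j = n - 1) → (⟨0, Nat.zero_lt_of_lt hp⟩ : Fin p) ∈ S) → R i j S := by
  induction k using Nat.strong_induction_on with
  | _ k ih =>
  set z : Fin p := ⟨0, Nat.zero_lt_of_lt hp⟩ with hz
  set o : Fin p := ⟨1, by omega⟩ with ho
  set F : ℕ → ℕ → Prop := fun i j => φ (i = m - 1) (j = n - 1) with hF
  have nF : ∀ {i j}, i ≠ m - 1 → j ≠ n - 1 → ¬F i j := by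
    intro i j hi hj
    simpa [hF, hi, hj] using hφ0
  have F0 : ∀ j, F 0 j ↔ F 1 j := by
    intro j
    simp only [hF, show ¬(0 = m - 1) by omega, show ¬(1 = m - 1) by omega]
  have F0' : ∀ i, F i 0 ↔ F i 1 := by
    intro i
    simp only [hF, show ¬(0 = n - 1) by omega, show ¬(1 = n - 1) by omega]
  have hzo : cyc z = o := Fin.ext (cyc_val_of_lt (by simp [hz]; omega))
  have image_pre : ∀ S : Set (Fin p), cyc '' (cyc ⁻¹' S) = S := fun S =>
    Set.image_preimage_eq S cyc_bijective.2
  have card_pre : ∀ S : Set (Fin p), (cyc ⁻¹' S).ncard = S.ncard := fun S => by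
    conv_rhs => rw [← image_pre S, Set.ncard_image_of_injective _ cyc_injective]
  have step : ∀ {i j : ℕ} (i' j' : ℕ) {T S : Set (Fin p)}, i < m → j < n → R i j T →
      (i + 1) % m = i' → (j + 1) % n = j' → cyc '' T ∪ {t | t = z ∧ F i' j'} = S →
      R i' j' S := by
    rintro i j i' j' T S hi hj hR rfl rfl rfl
    exact ha i j T hi hj hR
  -- Rotating without adding anything new.
  have rot : ∀ {i j : ℕ} (i' j' : ℕ) {S : Set (Fin p)}, i < m → j < n → R i j (cyc ⁻¹' S) →
      (i + 1) % m = i' → (j + 1) % n = j' → (F i' j' → z ∈ S) → R i' j' S := by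
    intro i j i' j' S hi hj hR hi' hj' hv
    refine step i' j' hi hj hR hi' hj' ?_
    rw [image_pre]
    refine Set.union_eq_left.2 ?_
    rintro t ⟨rfl, ht⟩
    exact hv ht
  have hb' : ∀ {j S}, j < n → o ∉ S → R 1 j S → R 0 j S := by
    intro j S hj hoS h
    have := hb j S hj h
    rwa [contr_image_of_notMem hp hoS] at this
  -- States whose first component is final.
  have hA : ∀ S : Set (Fin p), S.ncard = k → z ∈ S → ∀ i j, i < m → j < n → F i j →
      R i j S := by
    intro S hS hzS i j hi hj hFij
    have hTcard : (cyc ⁻¹' (S \ {z})).ncard < k := by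
      rw [card_pre, ← hS]
      exact Set.ncard_sdiff_singleton_lt_of_mem hzS
    have grow : ∀ {i j : ℕ} (i' j' : ℕ), i < m → j < n → (F i j → o ∈ S) →
        (i + 1) % m = i' → (j + 1) % n = j' → F i' j' → R i' j' S := by
      intro i j i' j' hi hj hv hi' hj' hF'
      refine step i' j' hi hj (ih _ hTcard _ rfl i j hi hj fun h => ?_) hi' hj' ?_
      · refine ⟨by rw [hzo]; exact hv h, ?_⟩
        rw [hzo]
        simp [hz, ho]
      · rw [image_pre]
        ext t
        by_cases ht : t = z <;> simp [ht, hF', hzS]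
    have inner : ∀ i j, i + 1 < m → j + 1 < n → F (i + 1) (j + 1) → R (i + 1) (j + 1) S :=
      fun i j hi hj h => grow (i + 1) (j + 1) (by omega) (by omega)
        (fun h' => absurd h' (nF (by omega) (by omega)))
        (Nat.mod_eq_of_lt hi) (Nat.mod_eq_of_lt hj) h
    rcases i with _ | i <;> rcases j with _ | j
    · exact absurd hFij (nF (by omega) (by omega))
    · by_cases hoS : o ∈ S
      · exact grow (i := m - 1) (j := j) 0 (j + 1) (by omega) (by omega) (fun _ => hoS)
          (by rw [Nat.sub_add_cancel (by omega), Nat.mod_self]) (Nat.mod_eq_of_lt hj) hFij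
      · exact hb' hj hoS (inner 0 j (by omega) hj ((F0 _).1 hFij))
    · exact hc _ _ hi (inner i 0 hi (by omega) ((F0' _).1 hFij))
    · exact inner i j hi hj hFij
  -- The initial first component.
  have hB : ∀ S : Set (Fin p), S.ncard = k → R 0 0 S := by
    have hB0 : ∀ S : Set (Fin p), S.ncard = k → o ∈ S → R 0 0 S := by
      intro S hS hoS
      have hzT : z ∈ cyc ⁻¹' S := by rw [Set.mem_preimage, hzo]; exact hoS
      rcases hφ1 with h | h
      · refine rot (i := m - 1) (j := n - 1) 0 0 (by omega) (by omega)
          (hA _ ((card_pre S).trans hS) hzT _ _ (by omega) (by omega) (by simpa [hF] using h))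
          (by rw [Nat.sub_add_cancel (by omega), Nat.mod_self])
          (by rw [Nat.sub_add_cancel (by omega), Nat.mod_self])
          fun h' => absurd h' (nF (by omega) (by omega))
      · refine hc 0 S (by omega) (rot (i := m - 1) (j := 0) 0 1 (by omega) (by omega)
          (hA _ ((card_pre S).trans hS) hzT _ _ (by omega) (by omega) ?_)
          (by rw [Nat.sub_add_cancel (by omega), Nat.mod_self])
          (Nat.mod_eq_of_lt (by omega))
          fun h' => absurd h' (nF (by omega) (by omega)))
        simpa [hF, show ¬(0 = n - 1) by omega] using h
    have hBd : ∀ (d : ℕ) (S : Set (Fin p)), S.ncard = k → cyc^[d] o ∈ S → R 0 0 S := by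
      intro d
      induction d with
      | zero => exact fun S hS h => hB0 S hS h
      | succ d ihd =>
        intro S hS h
        by_cases hoS : o ∈ S
        · exact hB0 S hS hoS
        · rw [iterate_succ_apply'] at h
          refine hc 0 S (by omega) (hb' (by omega) hoS (rot (i := 0) (j := 0) 1 1 (by omega)
            (by omega) (ihd _ ((card_pre S).trans hS) h) (Nat.mod_eq_of_lt (by omega))
            (Nat.mod_eq_of_lt (by omega)) fun h' => absurd h' (nF (by omega) (by omega))))
    intro S hS
    rcases S.eq_empty_or_nonempty with rfl | ⟨x, hx⟩
    · exact h0
    · refine hBd (x.val + p - 1) S hS ?_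
      convert hx
      apply Fin.ext
      rw [cyc_iterate_val]
      simp only [ho]
      rw [show 1 + (x.val + p - 1) = x.val + p by omega, Nat.add_mod_right,
        Nat.mod_eq_of_lt x.isLt]
  have hC : ∀ i, i < m → ∀ S : Set (Fin p), S.ncard = k → ¬F i 0 → R i 0 S := by
    intro i
    induction i with
    | zero => exact fun _ S hS _ => hB S hS
    | succ i ihi =>
      intro hi S hS hnF
      exact hc _ _ hi (rot (i := i) (j := 0) (i + 1) 1 (by omega) (by omega)
        (ihi (by omega) _ ((card_pre S).trans hS) (nF (by omega) (by omega)))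
        (Nat.mod_eq_of_lt hi) (Nat.mod_eq_of_lt (by omega))
        fun h' => absurd ((F0' _).2 h') hnF)
  have hD : ∀ j, j < n → ∀ i, i < m → ∀ S : Set (Fin p), S.ncard = k → ¬F i j → R i j S := by
    intro j
    induction j with
    | zero => exact fun _ i hi S hS h => hC i hi S hS h
    | succ j ihj =>
      intro hj i hi S hS hnF
      have inner : ∀ i, i + 1 < m → ¬F (i + 1) (j + 1) → R (i + 1) (j + 1) S := by
        intro i hi hnF
        exact rot (i := i) (j := j) (i + 1) (j + 1) (by omega) (by omega)
          (ihj (by omega) i (by omega) _ ((card_pre S).trans hS) (nF (by omega) (by omega)))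
          (Nat.mod_eq_of_lt hi) (Nat.mod_eq_of_lt hj) fun h' => absurd h' hnF
      rcases i with _ | i
      · by_cases hoS : o ∈ S
        · refine rot (i := m - 1) (j := j) 0 (j + 1) (by omega) (by omega) ?_
            (by rw [Nat.sub_add_cancel (by omega), Nat.mod_self]) (Nat.mod_eq_of_lt hj)
            fun h' => absurd h' hnF
          by_cases hF' : F (m - 1) j
          · refine hA _ ((card_pre S).trans hS) ?_ _ _ (by omega) (by omega) hF'
            rw [Set.mem_preimage, hzo]
            exact hoS
          · exact ihj (by omega) _ (by omega) _ ((card_pre S).trans hS) hF'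
        · exact hb' hj hoS (inner 0 (by omega) fun h => hnF ((F0 _).2 h))
      · exact inner i hi hnF
  intro S hS i j hi hj hv
  by_cases h : F i j
  · exact hA S hS (hv h) i j hi hj h
  · exact hD j hj i hi S hS h

section Words

/-- A subgroup containing `f (swap 0 1)` and an element that conjugates `f σ` to
`f (ρ * σ * ρ⁻¹)`, where `ρ` is the cycle, contains the range of `f`. -/
theorem map_perm_mem {n : ℕ} (hn : 3 ≤ n) {G : Type*} [Group G] (f : Equiv.Perm (Fin n) →* G)
    (H : Subgroup G) (r : G) (hr : r ∈ H)
    (hconj : ∀ σ, r * f σ * r⁻¹ =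
      f (Equiv.ofBijective cyc cyc_bijective * σ * (Equiv.ofBijective cyc cyc_bijective)⁻¹))
    (h01 : f (Equiv.swap ⟨0, by omega⟩ ⟨1, by omega⟩) ∈ H) (σ : Equiv.Perm (Fin n)) :
    f σ ∈ H := by
  have hadj : ∀ (k : ℕ) (hk : k + 1 < n),
      f (Equiv.swap ⟨k, by omega⟩ ⟨k + 1, hk⟩) ∈ H := by
    intro k
    induction k with
    | zero => exact fun _ => h01
    | succ k ih =>
      intro hk
      have h := H.mul_mem (H.mul_mem hr (ih (by omega))) (H.inv_mem hr)
      rw [hconj, ← Equiv.swap_apply_apply] at h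
      convert h using 3
      · exact Fin.ext (cyc_val_of_lt (x := ⟨k, by omega⟩) (by omega : k + 1 < n)).symm
      · exact Fin.ext (cyc_val_of_lt (x := ⟨k + 1, by omega⟩) hk).symm
  obtain ⟨k, rfl⟩ : ∃ k, n = k + 1 := ⟨n - 1, by omega⟩
  have hle : Submonoid.closure (Set.range fun i : Fin k => Equiv.swap i.castSucc i.succ) ≤
      (H.comap f).toSubmonoid := by
    rw [Submonoid.closure_le]
    rintro _ ⟨i, rfl⟩
    exact hadj i.val (by omega)
  rw [Equiv.Perm.mclosure_swap_castSucc_succ] at hle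
  exact hle (Submonoid.mem_top σ)

/-- Every pair of permutations is the action of some word on the product of the first two
automata. -/
theorem exists_evalFrom_eq {m n : ℕ} (hm : 3 ≤ m) (hn : 3 ≤ n) (φ : Prop → Prop → Prop)
    (g : Equiv.Perm (Fin m) × Equiv.Perm (Fin n)) :
    ∃ w, ∀ q, (prodDFA φ (YA m (Nat.zero_lt_of_lt hm)) (YB n (Nat.zero_lt_of_lt hn))).evalFrom q w =
      (g.1 q.1, g.2 q.2) := by
  let K : Submonoid (Equiv.Perm (Fin m) × Equiv.Perm (Fin n)) :=
    { carrier := {g | ∃ w, ∀ q,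
        (prodDFA φ (YA m (Nat.zero_lt_of_lt hm)) (YB n (Nat.zero_lt_of_lt hn))).evalFrom q w =
        (g.1 q.1, g.2 q.2)}
      one_mem' := ⟨[], fun q => rfl⟩
      mul_mem' := by
        rintro g h ⟨u, hu⟩ ⟨v, hv⟩
        exact ⟨v ++ u, fun q => by rw [DFA.evalFrom_of_append, hv, hu]; rfl⟩ }
  let H : Subgroup (Equiv.Perm (Fin m) × Equiv.Perm (Fin n)) :=
    { K with
      inv_mem' := by
        intro x hx
        have h : x⁻¹ = x ^ (Nat.card (Equiv.Perm (Fin m) × Equiv.Perm (Fin n)) - 1) := by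
          rw [inv_eq_iff_mul_eq_one, ← pow_succ', Nat.sub_add_cancel Nat.card_pos,
            pow_card_eq_one']
        rw [h]
        exact K.pow_mem hx _ }
  set ρ := Equiv.ofBijective (cyc (n := m)) cyc_bijective
  set ρ' := Equiv.ofBijective (cyc (n := n)) cyc_bijective
  have hr : (ρ, ρ') ∈ H := ⟨[ABC.a], fun q => rfl⟩
  have h1 : ∀ σ, (σ, (1 : Equiv.Perm (Fin n))) ∈ H := by
    refine map_perm_mem hm (MonoidHom.inl _ _) H _ hr (fun σ => ?_) ⟨[ABC.b], fun q => ?_⟩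
    · exact Prod.ext rfl (by simp)
    · exact Prod.ext (transp_eq_swap hm q.1) rfl
  have h2 : ∀ τ, ((1 : Equiv.Perm (Fin m)), τ) ∈ H := by
    refine map_perm_mem hn (MonoidHom.inr _ _) H _ hr (fun σ => ?_) ⟨[ABC.c], fun q => ?_⟩
    · exact Prod.ext (by simp) rfl
    · exact Prod.ext rfl (transp_eq_swap hn q.2)
  have h : ((g.1, 1) * (1, g.2) : Equiv.Perm (Fin m) × Equiv.Perm (Fin n)) ∈ H :=
    H.mul_mem (h1 g.1) (h2 g.2)
  rwa [Prod.mk_mul_mk, mul_one, one_mul] at h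

/-- Permutations acting independently on both coordinates separate points with different first
coordinates. -/
theorem fst_eq_of_forall_perm {X Y : Type} [DecidableEq X] [DecidableEq Y] (x₀ : X) (y₀ : Y)
    (φ : Prop → Prop → Prop) (hφ0 : ¬φ False False)
    (hφ : φ True False ∨ (φ True True ∧ ¬φ False True)) {i i' : X} {j j' : Y}
    (hY : ∃ z : Y, z ≠ j ∧ z ≠ j')
    (h : ∀ (σ : Equiv.Perm X) (τ : Equiv.Perm Y),
      φ (σ i = x₀) (τ j = y₀) ↔ φ (σ i' = x₀) (τ j' = y₀)) : i = i' := by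
  by_contra hne
  have hswap : ∀ {Z : Type} [DecidableEq Z] (a b z : Z), Equiv.swap a b z = b ↔ a = z := by
    intro Z _ a b z
    rw [Equiv.swap_apply_eq_iff, Equiv.swap_apply_right, eq_comm]
  rcases hφ with hφ | ⟨hφ, hφ'⟩
  · obtain ⟨z, hz, hz'⟩ := hY
    have := h (Equiv.swap i x₀) (Equiv.swap z y₀)
    simp only [hswap, hne, hz, hz', hφ, hφ0] at this
    simp at this
  · have := h (Equiv.swap i x₀) (Equiv.swap j y₀)
    simp only [hswap, hne, hφ, true_iff] at this
    by_cases hj : j = j' <;> simp_all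

end Words

section Concatenation

theorem mem_accept_brzDFA_iff {α : Type} {n : ℕ} (hn : 0 < n) (f : α → Fin n → Fin n)
    (x : Fin n) : x ∈ (brzDFA n hn f).accept ↔ x.val = n - 1 :=
  Fin.ext_iff

variable {m n p : ℕ}

/-- The DFA for a Boolean combination of the first two witness languages. -/
abbrev boolDFA (φ : Prop → Prop → Prop) (hm : 3 ≤ m) (hn : 3 ≤ n) : DFA ABC (Fin m × Fin n) :=
  prodDFA φ (YA m (Nat.zero_lt_of_lt hm)) (YB n (Nat.zero_lt_of_lt hn))

/-- The subset-construction DFA for the concatenation of a Boolean combination of the first two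
witness languages with the third one. -/
abbrev witnessDFA (φ : Prop → Prop → Prop) (hm : 3 ≤ m) (hn : 3 ≤ n) (hp : 3 ≤ p) :
    DFA ABC ((Fin m × Fin n) × Set (Fin p)) :=
  concatDFA (boolDFA φ hm hn) (YC p (Nat.zero_lt_of_lt hp))

variable (φ : Prop → Prop → Prop) (hm : 3 ≤ m) (hn : 3 ≤ n) (hp : 3 ≤ p)

theorem mem_accept_boolDFA_iff (q : Fin m × Fin n) :
    q ∈ (boolDFA φ hm hn).accept ↔ φ (q.1.val = m - 1) (q.2.val = n - 1) :=
  iff_of_eq (congrArg₂ φ (propext (mem_accept_brzDFA_iff _ _ q.1))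
    (propext (mem_accept_brzDFA_iff _ _ q.2)))

theorem mem_witnessDFA_step_snd {s : (Fin m × Fin n) × Set (Fin p)} {x : ABC} {t : Fin p} :
    t ∈ ((witnessDFA φ hm hn hp).step s x).2 ↔
      t ∈ (fun t => (YC p (Nat.zero_lt_of_lt hp)).step t x) '' s.2 ∨
        (t = ⟨0, Nat.zero_lt_of_lt hp⟩ ∧ (boolDFA φ hm hn).step s.1 x ∈ (boolDFA φ hm hn).accept) :=
  Iff.rfl

/-- After a letter that is not the cycle, membership of the Boolean component in the final states
is unchanged. -/
theorem step_mem_accept_boolDFA_iff (q : Fin m × Fin n) {x : ABC} (hx : x ≠ ABC.a) :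
    (boolDFA φ hm hn).step q x ∈ (boolDFA φ hm hn).accept ↔ q ∈ (boolDFA φ hm hn).accept := by
  rw [mem_accept_boolDFA_iff, mem_accept_boolDFA_iff]
  cases x with
  | a => exact absurd rfl hx
  | b => exact iff_of_eq (congrArg₂ φ (propext (transp_val_eq_last_iff hm q.1)) rfl)
  | c => exact iff_of_eq (congrArg₂ φ rfl (propext (transp_val_eq_last_iff hn q.2)))

theorem zero_mem_of_mem_accept (w : List ABC)
    (h : ((witnessDFA φ hm hn hp).eval w).1 ∈ (boolDFA φ hm hn).accept) :
    (⟨0, Nat.zero_lt_of_lt hp⟩ : Fin p) ∈ ((witnessDFA φ hm hn hp).eval w).2 := by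
  rcases List.eq_nil_or_concat w with rfl | ⟨w, x, rfl⟩
  · exact ⟨rfl, h⟩
  · rw [List.concat_eq_append, DFA.eval_append_singleton] at h ⊢
    exact Or.inr ⟨rfl, h⟩

theorem cyc_mem_step_snd_iff {s : (Fin m × Fin n) × Set (Fin p)} {x : Fin p}
    (hx : x.val + 1 < p) :
    cyc x ∈ ((witnessDFA φ hm hn hp).step s ABC.a).2 ↔ x ∈ s.2 := by
  rw [mem_witnessDFA_step_snd]
  constructor
  · rintro (⟨y, hy, hxy⟩ | ⟨h0, -⟩)
    · rwa [← cyc_injective hxy]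
    · exact absurd h0 (cyc_ne_zero hx)
  · exact fun h => Or.inl ⟨x, h, rfl⟩

theorem snd_subset_of_acceptsFrom_eq (k : ℕ) :
    ∀ (x : Fin p), x.val + k + 1 = p → ∀ s t : (Fin m × Fin n) × Set (Fin p),
      (witnessDFA φ hm hn hp).acceptsFrom s = (witnessDFA φ hm hn hp).acceptsFrom t →
      x ∈ s.2 → x ∈ t.2 := by
  induction k with
  | zero =>
    intro x hx s t hst hxs
    have hlast : ∀ y : Fin p, y ∈ (YC p (Nat.zero_lt_of_lt hp)).accept ↔ y = x := fun y => by
      rw [YC, mem_accept_brzDFA_iff, Fin.ext_iff]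
      omega
    have h : [] ∈ (witnessDFA φ hm hn hp).acceptsFrom s := ⟨x, hxs, (hlast x).2 rfl⟩
    rw [hst] at h
    obtain ⟨y, hy, hacc⟩ := h
    rwa [← (hlast y).1 hacc]
  | succ k ih =>
    intro x hx s t hst hxs
    have h1 : x.val + 1 < p := by omega
    rw [← cyc_mem_step_snd_iff φ hm hn hp h1] at hxs ⊢
    exact ih (cyc x) (by rw [cyc_val_of_lt h1]; omega) _ _
      (acceptsFrom_evalFrom_eq _ hst [ABC.a]) hxs

theorem snd_eq_of_acceptsFrom_eq {s t : (Fin m × Fin n) × Set (Fin p)}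
    (h : (witnessDFA φ hm hn hp).acceptsFrom s = (witnessDFA φ hm hn hp).acceptsFrom t) :
    s.2 = t.2 := by
  ext x
  have hx : x.val + (p - 1 - x.val) + 1 = p := by omega
  exact ⟨snd_subset_of_acceptsFrom_eq φ hm hn hp _ x hx s t h,
    snd_subset_of_acceptsFrom_eq φ hm hn hp _ x hx t s h.symm⟩

/-- If `x` is missing from the subset component of two indistinguishable states, their Boolean
components agree about finality when `x` has been rotated to `0`. -/
theorem mem_accept_iff_of_notMem (k : ℕ) :
    ∀ (x : Fin p), x.val + k + 1 = p → ∀ s t : (Fin m × Fin n) × Set (Fin p),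
      (witnessDFA φ hm hn hp).acceptsFrom s = (witnessDFA φ hm hn hp).acceptsFrom t →
      x ∉ s.2 →
      ((boolDFA φ hm hn).evalFrom s.1 (List.replicate (k + 1) ABC.a) ∈
          (boolDFA φ hm hn).accept ↔
        (boolDFA φ hm hn).evalFrom t.1 (List.replicate (k + 1) ABC.a) ∈
          (boolDFA φ hm hn).accept) := by
  induction k with
  | zero =>
    intro x hx s t hst hxs
    have hxt : x ∉ t.2 := by rwa [← snd_eq_of_acceptsFrom_eq φ hm hn hp hst]
    have h0 : cyc x = ⟨0, by omega⟩ := Fin.ext (cyc_val_of_eq hx)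
    have key : ∀ r : (Fin m × Fin n) × Set (Fin p), x ∉ r.2 →
        (cyc x ∈ ((witnessDFA φ hm hn hp).step r ABC.a).2 ↔
          (boolDFA φ hm hn).step r.1 ABC.a ∈ (boolDFA φ hm hn).accept) := by
      intro r hr
      rw [mem_witnessDFA_step_snd]
      constructor
      · rintro (⟨y, hy, hxy⟩ | ⟨-, h⟩)
        · exact absurd (cyc_injective hxy ▸ hy) hr
        · exact h
      · exact fun h => Or.inr ⟨h0, h⟩
    have h := snd_eq_of_acceptsFrom_eq φ hm hn hp (acceptsFrom_evalFrom_eq _ hst [ABC.a])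
    exact (key s hxs).symm.trans ((Set.ext_iff.1 h (cyc x)).trans (key t hxt))
  | succ k ih =>
    intro x hx s t hst hxs
    have h1 : x.val + 1 < p := by omega
    rw [← cyc_mem_step_snd_iff φ hm hn hp h1] at hxs
    exact ih (cyc x) (by rw [cyc_val_of_lt h1]; omega) _ _
      (acceptsFrom_evalFrom_eq _ hst [ABC.a]) hxs

theorem exists_perm_evalFrom_eq (w : List ABC) :
    ∃ g : Equiv.Perm (Fin m) × Equiv.Perm (Fin n),
      ∀ q, (boolDFA φ hm hn).evalFrom q w = (g.1 q.1, g.2 q.2) := by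
  induction w with
  | nil => exact ⟨1, fun q => rfl⟩
  | cons x w ih =>
    obtain ⟨g, hg⟩ := ih
    obtain ⟨h, hh⟩ : ∃ h : Equiv.Perm (Fin m) × Equiv.Perm (Fin n),
        ∀ q, (boolDFA φ hm hn).step q x = (h.1 q.1, h.2 q.2) := by
      cases x with
      | a => exact ⟨(Equiv.ofBijective cyc cyc_bijective, Equiv.ofBijective cyc cyc_bijective),
          fun q => rfl⟩
      | b => exact ⟨(Equiv.swap ⟨0, by omega⟩ ⟨1, by omega⟩, 1),
          fun q => Prod.ext (transp_eq_swap hm q.1) rfl⟩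
      | c => exact ⟨(1, Equiv.swap ⟨0, by omega⟩ ⟨1, by omega⟩),
          fun q => Prod.ext rfl (transp_eq_swap hn q.2)⟩
    exact ⟨g * h, fun q => by rw [DFA.evalFrom_cons, hh, hg]; rfl⟩

theorem perm_mem_accept_iff {s t : (Fin m × Fin n) × Set (Fin p)}
    (hst : (witnessDFA φ hm hn hp).acceptsFrom s = (witnessDFA φ hm hn hp).acceptsFrom t)
    (σ : Equiv.Perm (Fin m)) (τ : Equiv.Perm (Fin n)) :
    (σ s.1.1, τ s.1.2) ∈ (boolDFA φ hm hn).accept ↔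
      (σ t.1.1, τ t.1.2) ∈ (boolDFA φ hm hn).accept := by
  obtain ⟨g, hg⟩ := exists_perm_evalFrom_eq φ hm hn
    ([ABC.b] ++ List.replicate (p - 2 + 1) ABC.a)
  obtain ⟨u, hu⟩ := exists_evalFrom_eq hm hn φ (g⁻¹ * (σ, τ))
  have key : ∀ r : (Fin m × Fin n) × Set (Fin p), (boolDFA φ hm hn).evalFrom
      ((witnessDFA φ hm hn hp).evalFrom r (u ++ [ABC.b])).1
        (List.replicate (p - 2 + 1) ABC.a) = (σ r.1.1, τ r.1.2) := by
    intro r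
    rw [concatDFA_evalFrom_fst, ← DFA.evalFrom_of_append, List.append_assoc,
      DFA.evalFrom_of_append, hg, hu]
    simp
  rw [← key s, ← key t]
  refine mem_accept_iff_of_notMem φ hm hn hp (p - 2) ⟨1, by omega⟩
    (show 1 + (p - 2) + 1 = p by omega) _ _ (acceptsFrom_evalFrom_eq _ hst _) ?_
  rw [DFA.evalFrom_append_singleton]
  rintro (h | ⟨h, -⟩)
  · exact one_notMem_contr_image hp _ h
  · simp [YC, brzDFA] at h

theorem exists_ne_ne (hn : 3 ≤ n) (j j' : Fin n) : ∃ z, z ≠ j ∧ z ≠ j' := by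
  have h : ({j, j'} : Finset (Fin n)).card < Fintype.card (Fin n) := by
    have := Finset.card_le_two (a := j) (b := j')
    rw [Fintype.card_fin]
    omega
  obtain ⟨z, hz⟩ := Finset.exists_mem_notMem_of_card_lt_card (s := {j, j'}) (t := Finset.univ) h
  exact ⟨z, by simpa using hz⟩

theorem acceptsFrom_witnessDFA_injective (hφ0 : ¬φ False False)
    (hφ : (φ True False ∧ φ False True) ∨ (φ True True ∧ ¬φ True False ∧ ¬φ False True)) :
    Injective (witnessDFA φ hm hn hp).acceptsFrom := by
  intro s t hst
  have hperm : ∀ (σ : Equiv.Perm (Fin m)) (τ : Equiv.Perm (Fin n)),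
      φ (σ s.1.1 = ⟨m - 1, by omega⟩) (τ s.1.2 = ⟨n - 1, by omega⟩) ↔
        φ (σ t.1.1 = ⟨m - 1, by omega⟩) (τ t.1.2 = ⟨n - 1, by omega⟩) :=
    perm_mem_accept_iff φ hm hn hp hst
  refine Prod.ext (Prod.ext ?_ ?_) (snd_eq_of_acceptsFrom_eq φ hm hn hp hst)
  · exact fst_eq_of_forall_perm _ _ φ hφ0 (by tauto) (exists_ne_ne hn _ _) hperm
  · exact fst_eq_of_forall_perm _ _ (fun x y => φ y x) hφ0 (by tauto) (exists_ne_ne hm _ _)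
      fun σ τ => hperm τ σ

theorem exists_eval_witnessDFA_eq (hφ0 : ¬φ False False) (hφ1 : φ True True ∨ φ True False)
    (s : (Fin m × Fin n) × Set (Fin p))
    (hs : s.1 ∈ (boolDFA φ hm hn).accept → (⟨0, Nat.zero_lt_of_lt hp⟩ : Fin p) ∈ s.2) :
    ∃ w, (witnessDFA φ hm hn hp).eval w = s := by
  have hstep : ∀ {s : (Fin m × Fin n) × Set (Fin p)} {x : ABC}, x ≠ ABC.a →
      (∃ w, (witnessDFA φ hm hn hp).eval w = s) →
      ∃ w, (witnessDFA φ hm hn hp).eval w = ((boolDFA φ hm hn).step s.1 x,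
        (fun t => (YC p (Nat.zero_lt_of_lt hp)).step t x) '' s.2) := by
    rintro s x hx ⟨w, rfl⟩
    refine ⟨w ++ [x], ?_⟩
    rw [DFA.eval_append_singleton]
    refine Prod.ext rfl (Set.union_eq_left.2 ?_)
    rintro t ⟨rfl, ht⟩
    rw [step_mem_accept_boolDFA_iff φ hm hn _ hx] at ht
    refine ⟨_, zero_mem_of_mem_accept φ hm hn hp w ht, ?_⟩
    cases x with
    | a => exact absurd rfl hx
    | b => rfl
    | c => rfl
  have := reach_of_valid hm hn hp φ hφ0 hφ1
    (fun i j S => ∃ (hi : i < m) (hj : j < n),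
      ∃ w, (witnessDFA φ hm hn hp).eval w = ((⟨i, hi⟩, ⟨j, hj⟩), S))
    ⟨by omega, by omega, [], ?_⟩ ?_ ?_ ?_ _ s.2 rfl s.1.1.val s.1.2.val s.1.1.isLt s.1.2.isLt
    (fun h => hs ((mem_accept_boolDFA_iff φ hm hn _).2 h))
  · obtain ⟨_, _, h⟩ := this
    exact h
  · refine Prod.ext rfl ?_
    ext t
    refine iff_of_false ?_ (Set.notMem_empty t)
    rintro ⟨-, h⟩
    rw [mem_accept_boolDFA_iff] at h
    change φ (0 = m - 1) (0 = n - 1) at h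
    rw [eq_false (show ¬(0 = m - 1) by omega), eq_false (show ¬(0 = n - 1) by omega)] at h
    exact hφ0 h
  · rintro i j S hi hj ⟨_, _, w, hw⟩
    refine ⟨Nat.mod_lt _ (by omega), Nat.mod_lt _ (by omega), w ++ [ABC.a], ?_⟩
    rw [DFA.eval_append_singleton, hw]
    refine Prod.ext rfl ?_
    ext t
    rw [mem_witnessDFA_step_snd, mem_accept_boolDFA_iff]
    rfl
  · rintro j S hj ⟨_, _, h⟩
    exact ⟨by omega, hj, hstep (x := ABC.b) nofun h⟩
  · rintro i S hi ⟨_, _, h⟩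
    obtain ⟨w, hw⟩ := hstep (x := ABC.c) nofun h
    exact ⟨hi, by omega, w, hw.trans (Prod.ext rfl (Set.image_id S))⟩

theorem sc_boolDFA_mul (hφ0 : ¬φ False False)
    (hφ : (φ True False ∧ φ False True) ∨ (φ True True ∧ ¬φ True False ∧ ¬φ False True)) :
    sc ((boolDFA φ hm hn).accepts * (YC p (Nat.zero_lt_of_lt hp)).accepts) =
      m * n * 2 ^ p - (boolDFA φ hm hn).accept.ncard * 2 ^ (p - 1) := by
  let W : Set ((Fin m × Fin n) × Set (Fin p)) :=
    (boolDFA φ hm hn).accept ×ˢ 𝒫 {(⟨0, Nat.zero_lt_of_lt hp⟩ : Fin p)}ᶜ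
  have hW : W.ncard = (boolDFA φ hm hn).accept.ncard * 2 ^ (p - 1) := by
    rw [Set.ncard_prod, Set.ncard_powerset, Set.ncard_compl, Set.ncard_singleton]
    simp
  have hV : ∀ s, s ∈ Wᶜ ↔
      (s.1 ∈ (boolDFA φ hm hn).accept → (⟨0, Nat.zero_lt_of_lt hp⟩ : Fin p) ∈ s.2) := by
    intro s
    simp only [W, Set.mem_compl_iff, Set.mem_prod, Set.mem_powerset_iff,
      Set.subset_compl_singleton_iff, not_and, not_not]
  rw [← concatDFA_accepts, sc_accepts_eq_ncard (witnessDFA φ hm hn hp) Wᶜ,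
    Set.ncard_compl, hW]
  · simp [Nat.card_eq_fintype_card]
  · intro s
    rw [hV]
    constructor
    · exact exists_eval_witnessDFA_eq φ hm hn hp hφ0 (by tauto) s
    · rintro ⟨w, rfl⟩
      exact zero_mem_of_mem_accept φ hm hn hp w
  · exact (acceptsFrom_witnessDFA_injective φ hm hn hp hφ0 hφ).injOn

end Concatenation

end BrzozowskiConcat

open BrzozowskiConcat in
theorem statement14 (m n p : ℕ) (hm : 3 ≤ m) (hn : 3 ≤ n) (hp : 3 ≤ p) :
    sc (((YA m (by omega)).accepts ⊓ (YB n (by omega)).accepts) * (YC p (by omega)).accepts) =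
        m * n * 2 ^ p - 2 ^ (p - 1) ∧
    sc (((YA m (by omega)).accepts ⊔ (YB n (by omega)).accepts) * (YC p (by omega)).accepts) =
        m * n * 2 ^ p - (m + n - 1) * 2 ^ (p - 1) ∧
    sc ((symmDiff (YA m (by omega)).accepts (YB n (by omega)).accepts) *
          (YC p (by omega)).accepts) =
        m * n * 2 ^ p - (m + n - 2) * 2 ^ (p - 1) := by
  have hcard : ∀ (φ : Prop → Prop → Prop) (hm : 3 ≤ m) (hn : 3 ≤ n) (A : Set (Fin m × Fin n)),
      (∀ q, φ (q.1.val = m - 1) (q.2.val = n - 1) ↔ q ∈ A) →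
      (boolDFA φ hm hn).accept.ncard = A.ncard := fun φ hm hn A hA =>
    congrArg Set.ncard (Set.ext fun q => (mem_accept_boolDFA_iff φ hm hn q).trans (hA q))
  let x : Fin m := ⟨m - 1, by omega⟩
  let y : Fin n := ⟨n - 1, by omega⟩
  have hx' : ∀ i : Fin m, i.val = m - 1 ↔ i = x := fun i => by rw [Fin.ext_iff]
  have hy' : ∀ j : Fin n, j.val = n - 1 ↔ j = y := fun j => by rw [Fin.ext_iff]
  have hcx : ({x}ᶜ : Set (Fin m)).ncard = m - 1 := by
    rw [Set.ncard_compl, Set.ncard_singleton, Nat.card_fin]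
  have hcy : ({y}ᶜ : Set (Fin n)).ncard = n - 1 := by
    rw [Set.ncard_compl, Set.ncard_singleton, Nat.card_fin]
  refine ⟨?_, ?_, ?_⟩
  · have h := sc_boolDFA_mul (fun a b => a ∧ b) hm hn hp (by simp) (by simp)
    rw [hcard _ hm hn ({x} ×ˢ {y}) (fun q => by simp [hx', hy', Prod.ext_iff]), Set.ncard_prod,
      Set.ncard_singleton, Set.ncard_singleton, one_mul, one_mul] at h
    rw [← h]
    congr 2
    ext w
    rw [mem_prodDFA_accepts]
    rfl
  · have h := sc_boolDFA_mul (fun a b => a ∨ b) hm hn hp (by simp) (by simp)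
    rw [hcard _ hm hn ({x} ×ˢ Set.univ ∪ {x}ᶜ ×ˢ {y}) (fun q => by simp [hx', hy']; tauto),
      Set.ncard_union_eq, Set.ncard_prod, Set.ncard_prod, Set.ncard_univ, hcx,
      Set.ncard_singleton, Set.ncard_singleton, Nat.card_fin, one_mul, mul_one,
      show n + (m - 1) = m + n - 1 by omega] at h
    · rw [← h]
      congr 2
      ext w
      rw [mem_prodDFA_accepts]
      rfl
    · rw [Set.disjoint_left]
      rintro q ⟨hq, -⟩ ⟨hq', -⟩
      exact hq' hq
  · have h := sc_boolDFA_mul (fun a b => (a ∧ ¬b) ∨ (b ∧ ¬a)) hm hn hp (by simp) (by simp)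
    rw [hcard _ hm hn ({x} ×ˢ {y}ᶜ ∪ {x}ᶜ ×ˢ {y}) (fun q => by simp [hx', hy']; tauto),
      Set.ncard_union_eq, Set.ncard_prod, Set.ncard_prod, hcx, hcy,
      Set.ncard_singleton, Set.ncard_singleton, one_mul, mul_one,
      show n - 1 + (m - 1) = m + n - 2 by omega] at h
    · rw [← h]
      congr 2
      ext w
      rw [mem_prodDFA_accepts]
      rfl
    · rw [Set.disjoint_left]
      rintro q ⟨hq, -⟩ ⟨hq', -⟩
      exact hq' hq
end

section
/- Let m,n,p ≥ 3 and, for a boolean connective ⊙ among disjunction, conjunction and exclusive-or, let R be the catenation DFA (X_m(a,b,−;{c}) ⊙ X_n(a,c,−;{b}))·X_p(a,−,b;{c}) over alphabet {a,b,c}, where the product automaton X_m ⊙ X_n has final states {(i,j) : (i = m−1) ⊙ (j = n−1)}; the states of R are triples (i,j,S) with 0 ≤ i ≤ m−1, 0 ≤ j ≤ n−1, S ⊆ {0,…,p−1}. Then a state (i,j,S) is reachable from the initial state of R if and only if ((i = m−1) ⊙ (j = n−1) implies 0 ∈ S). -/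
/-- Product DFA of two DFAs, with acceptance given by applying the boolean
connective `o` to the two components' acceptance. -/
def prodDFA {α σB σC : Type} (B : DFA α σB) (C : DFA α σC) (o : Prop → Prop → Prop) :
    DFA α (σB × σC) where
  step q x := (B.step q.1 x, C.step q.2 x)
  start := (B.start, C.start)
  accept := {q | o (q.1 ∈ B.accept) (q.2 ∈ C.accept)}

open Classical in
/-- Catenation DFA of two DFAs. -/
noncomputable def catDFA {α σA σM : Type} (A : DFA α σA) (M : DFA α σM) :
    DFA α (σA × Set σM) where
  step q x :=
    (A.step q.1 x,
      if A.step q.1 x ∈ A.accept then (fun s => M.step s x) '' q.2 ∪ {M.start}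
      else (fun s => M.step s x) '' q.2)
  start := (A.start, if A.start ∈ A.accept then {M.start} else ∅)
  accept := {q | (q.2 ∩ M.accept).Nonempty}

/-- Two states of a DFA are equivalent if no word separates them. -/
def equivStates {α σ : Type} (D : DFA α σ) (q₁ q₂ : σ) : Prop :=
  ∀ w : List α, (D.evalFrom q₁ w ∈ D.accept ↔ D.evalFrom q₂ w ∈ D.accept)

theorem cyc_bijective {n : ℕ} : Function.Bijective (cyc (n := n)) := by
  rw [Finite.injective_iff_bijective.symm]
  intro x y h
  simp only [cyc, Fin.mk.injEq] at h
  have h' : x.val ≡ y.val [MOD n] := Nat.ModEq.add_right_cancel' 1 h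
  exact Fin.ext (h'.eq_of_lt_of_lt x.isLt y.isLt)

theorem cyc_zero {n : ℕ} (hn : 1 < n) : cyc (⟨0, by omega⟩ : Fin n) = ⟨1, hn⟩ :=
  Fin.ext (Nat.mod_eq_of_lt hn)

theorem ncard_preimage_cyc {n : ℕ} (S : Set (Fin n)) : (cyc ⁻¹' S).ncard = S.ncard :=
  Set.ncard_preimage_of_injective_subset_range cyc_bijective.1
    (by rw [cyc_bijective.2.range_eq]; exact Set.subset_univ S)

theorem pos_of_three_le {n : ℕ} (h : 3 ≤ n) : 0 < n := by omega

theorem one_lt_of_three_le {n : ℕ} (h : 3 ≤ n) : 1 < n := by omega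

/-- Closure properties of a relation `R` on triples `(i, j, S)` that hold for reachability in the
catenation DFA; `F i j` says that `(i, j)` is final in the product automaton. -/
structure ReachRules (m n p : ℕ) (hp : 3 ≤ p) (F : ℕ → ℕ → Prop)
    (R : ℕ → ℕ → Set (Fin p) → Prop) : Prop where
  three_le_left : 3 ≤ m
  three_le_right : 3 ≤ n
  not_final : ∀ i j, i < m - 1 → j < n - 1 → ¬ F i j
  final_last : F (m - 1) 0 ∨ F (m - 1) (n - 1)
  final_left : ∀ j, F 0 j ↔ F 1 j
  final_right : ∀ i, F i 0 ↔ F i 1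
  start : R 0 0 ∅
  swap_right : ∀ i S, R i 0 S ↔ R i 1 S
  swap_left : ∀ j S, (F 1 j → (⟨0, pos_of_three_le hp⟩ : Fin p) ∈ S) →
    (⟨1, one_lt_of_three_le hp⟩ : Fin p) ∉ S → R 1 j S → R 0 j S
  rotate : ∀ i j i' j' S, (i' + 1) % m = i → (j' + 1) % n = j →
    (F i j → (⟨0, pos_of_three_le hp⟩ : Fin p) ∈ S) → R i' j' (cyc ⁻¹' S) → R i j S
  insert : ∀ i j i' j' S, (i' + 1) % m = i → (j' + 1) % n = j →
    F i j → (⟨0, pos_of_three_le hp⟩ : Fin p) ∈ S →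
    R i' j' (cyc ⁻¹' (S \ {⟨0, pos_of_three_le hp⟩})) → R i j S

namespace ReachRules

variable {m n p : ℕ} {hp : 3 ≤ p} {F : ℕ → ℕ → Prop} {R : ℕ → ℕ → Set (Fin p) → Prop}

/-- Final states are reached from states with a smaller third component. -/
theorem of_final (h : ReachRules m n p hp F R) {k : ℕ}
    (ih : ∀ i j S, i < m → j < n → (F i j → (⟨0, pos_of_three_le hp⟩ : Fin p) ∈ S) → S.ncard < k →
      R i j S)
    {i j : ℕ} {S : Set (Fin p)} (hi : i < m) (hj : j < n) (hF : F i j)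
    (h0 : (⟨0, pos_of_three_le hp⟩ : Fin p) ∈ S) (hk : S.ncard = k) : R i j S := by
  have hm := h.three_le_left
  have hn := h.three_le_right
  have hT : (cyc ⁻¹' (S \ {⟨0, pos_of_three_le hp⟩}) : Set (Fin p)).ncard < k := by
    rw [ncard_preimage_cyc, ← hk]
    exact Set.ncard_sdiff_singleton_lt_of_mem h0
  have key : ∀ i j, i + 1 < m → j + 1 < n → F (i + 1) (j + 1) → R (i + 1) (j + 1) S := by
    intro i j hi hj hF
    refine h.insert _ _ i j S (Nat.mod_eq_of_lt hi) (Nat.mod_eq_of_lt hj) hF h0 ?_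
    exact ih _ _ _ (by omega) (by omega)
      (fun hF' => absurd hF' (h.not_final _ _ (by omega) (by omega))) hT
  rcases i with _ | i
  · rcases j with _ | j
    · exact absurd hF (h.not_final _ _ (by omega) (by omega))
    · by_cases h1 : (⟨1, one_lt_of_three_le hp⟩ : Fin p) ∈ S
      · refine h.insert _ _ (m - 1) j S
          (by rw [Nat.sub_add_cancel (by omega : 1 ≤ m), Nat.mod_self])
          (Nat.mod_eq_of_lt hj) hF h0 (ih _ _ _ (by omega) (by omega) (fun _ => ?_) hT)
        simp [cyc_zero (show 1 < p by omega), h1]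
      · exact h.swap_left _ _ (fun _ => h0) h1 (key 0 j (by omega) hj ((h.final_left _).1 hF))
  · rcases j with _ | j
    · exact (h.swap_right _ _).2 (key i 0 hi (by omega) ((h.final_right _).1 hF))
    · exact key i j hi hj hF

/-- States `(0, 0, S)` with `S` nonempty, by induction on an element of `S` taken in `1, …, p`. -/
theorem of_zero_zero (h : ReachRules m n p hp F R) {k : ℕ}
    (hfin : ∀ i j S, i < m → j < n → F i j → (⟨0, pos_of_three_le hp⟩ : Fin p) ∈ S → S.ncard = k →
      R i j S) (r : ℕ) :
    ∀ S : Set (Fin p), S.ncard = k →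
      (⟨(r + 1) % p, Nat.mod_lt _ (pos_of_three_le hp)⟩ : Fin p) ∈ S → R 0 0 S := by
  have hm := h.three_le_left
  have hn := h.three_le_right
  have hone : ∀ S : Set (Fin p), S.ncard = k → (⟨1, one_lt_of_three_le hp⟩ : Fin p) ∈ S →
      R 0 0 S := by
    intro S hS h1
    have h0 : (⟨0, pos_of_three_le hp⟩ : Fin p) ∈ cyc ⁻¹' S := by
      simpa [cyc_zero (show 1 < p by omega)] using h1
    have hT := (ncard_preimage_cyc S).trans hS
    have hmod : (m - 1 + 1) % m = 0 := by rw [Nat.sub_add_cancel (by omega : 1 ≤ m), Nat.mod_self]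
    rcases h.final_last with hF | hF
    · refine (h.swap_right _ _).2 (h.rotate _ _ (m - 1) 0 S hmod (Nat.mod_eq_of_lt (by omega))
        (fun hF' => absurd hF' (h.not_final _ _ (by omega) (by omega))) ?_)
      exact hfin _ _ _ (by omega) (by omega) hF h0 hT
    · refine h.rotate _ _ (m - 1) (n - 1) S hmod
        (by rw [Nat.sub_add_cancel (by omega : 1 ≤ n), Nat.mod_self])
        (fun hF' => absurd hF' (h.not_final _ _ (by omega) (by omega))) ?_
      exact hfin _ _ _ (by omega) (by omega) hF h0 hT
  induction r with
  | zero =>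
    intro S hS h1
    refine hone S hS ?_
    simpa [Nat.mod_eq_of_lt (show 1 < p by omega)] using h1
  | succ r ihr =>
    intro S hS hr
    by_cases h1 : (⟨1, one_lt_of_three_le hp⟩ : Fin p) ∈ S
    · exact hone S hS h1
    · have hnf : ¬ F 1 1 := h.not_final _ _ (by omega) (by omega)
      refine (h.swap_right _ _).2 (h.swap_left _ _ (fun hF => absurd hF hnf) h1 ?_)
      refine h.rotate _ _ 0 0 S (Nat.mod_eq_of_lt (by omega)) (Nat.mod_eq_of_lt (by omega))
        (fun hF => absurd hF hnf) (ihr _ ((ncard_preimage_cyc S).trans hS) ?_)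
      simpa [cyc] using hr

theorem reach (h : ReachRules m n p hp F R) (k : ℕ) : ∀ i j S, i < m → j < n →
    (F i j → (⟨0, pos_of_three_le hp⟩ : Fin p) ∈ S) → S.ncard = k → R i j S := by
  have hm := h.three_le_left
  have hn := h.three_le_right
  induction k using Nat.strong_induction_on with
  | _ k ih =>
  have hfin : ∀ i j S, i < m → j < n → F i j → (⟨0, pos_of_three_le hp⟩ : Fin p) ∈ S → S.ncard = k →
      R i j S := fun i j S hi hj hF h0 hk =>
    h.of_final (fun i j S hi hj hv hlt => ih _ hlt i j S hi hj hv rfl) hi hj hF h0 hk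
  have hzero : ∀ S : Set (Fin p), S.ncard = k → R 0 0 S := by
    intro S hS
    rcases S.eq_empty_or_nonempty with rfl | ⟨s, hs⟩
    · exact h.start
    · refine h.of_zero_zero hfin (s.val + p - 1) S hS ?_
      have : (⟨(s.val + p - 1 + 1) % p, Nat.mod_lt _ (pos_of_three_le hp)⟩ : Fin p) = s := by
        apply Fin.ext
        simp only
        rw [show s.val + p - 1 + 1 = s.val + p by omega, Nat.add_mod_right,
          Nat.mod_eq_of_lt s.isLt]
      rwa [this]
  have hcol : ∀ i, i < m → ¬ F i 1 → ∀ S : Set (Fin p), S.ncard = k → R i 0 S := by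
    intro i
    induction i with
    | zero => exact fun _ _ => hzero
    | succ i ihi =>
      intro hi hnf S hS
      refine (h.swap_right _ _).2 (h.rotate _ _ i 0 S (Nat.mod_eq_of_lt hi)
        (Nat.mod_eq_of_lt (by omega)) (fun hF => absurd hF hnf) ?_)
      exact ihi (by omega) (h.not_final _ _ (by omega) (by omega)) _
        ((ncard_preimage_cyc S).trans hS)
  intro i j
  induction j generalizing i with
  | zero =>
    intro S hi hj hv hS
    by_cases hF : F i 0
    · exact hfin _ _ _ hi hj hF (hv hF) hS
    · exact hcol i hi (fun h1 => hF ((h.final_right _).2 h1)) S hS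
  | succ j ihj =>
    intro S hi hj hv hS
    by_cases hF : F i (j + 1)
    · exact hfin _ _ _ hi hj hF (hv hF) hS
    have hT := (ncard_preimage_cyc S).trans hS
    have key : ∀ i, i + 1 < m → ¬ F (i + 1) (j + 1) → R (i + 1) (j + 1) S := by
      intro i hi hnf
      refine h.rotate _ _ i j S (Nat.mod_eq_of_lt hi) (Nat.mod_eq_of_lt hj)
        (fun hF => absurd hF hnf) (ihj i _ (by omega) (by omega) (fun hF => ?_) hT)
      exact absurd hF (h.not_final _ _ (by omega) (by omega))
    rcases i with _ | i
    · by_cases h1 : (⟨1, one_lt_of_three_le hp⟩ : Fin p) ∈ S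
      · refine h.rotate _ _ (m - 1) j S
          (by rw [Nat.sub_add_cancel (by omega : 1 ≤ m), Nat.mod_self])
          (Nat.mod_eq_of_lt hj) hv (ihj _ _ (by omega) (by omega) (fun _ => ?_) hT)
        simpa [cyc_zero (show 1 < p by omega)] using h1
      · have hnf : ¬ F 1 (j + 1) := fun h' => hF ((h.final_left _).2 h')
        exact h.swap_left _ _ (fun h' => absurd h' hnf) h1 (key 0 (by omega) hnf)
    · exact key i hi hF

end ReachRules

theorem contr_image_of_notMem {p : ℕ} (hp : 1 < p) {S : Set (Fin p)}
    (h1 : (⟨1, hp⟩ : Fin p) ∉ S) : contr '' S = S := by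
  have : Set.EqOn contr id S := by
    intro s hs
    have : s.val ≠ 1 := fun h => h1 (by convert hs; exact h.symm)
    simp [contr, this]
  rw [this.image_eq, Set.image_id]

/-- The catenation DFA of the theorem. -/
noncomputable abbrev boolCatDFA {m n p : ℕ} (hm : 0 < m) (hn : 0 < n) (hp : 0 < p)
    (o : Prop → Prop → Prop) : DFA ABC ((Fin m × Fin n) × Set (Fin p)) :=
  catDFA (prodDFA (YA m hm) (YB n hn) o) (YC p hp)

/-- One letter of `boolCatDFA`, in terms of the resulting first two components. -/
theorem boolCatDFA_step_eq {m n p : ℕ} (hm : 0 < m) (hn : 0 < n) (hp : 0 < p)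
    (o : Prop → Prop → Prop) (i : Fin m) (j : Fin n) (S T : Set (Fin p)) (x : ABC)
    (i' : Fin m) (j' : Fin n) (hi : (YA m hm).step i x = i') (hj : (YB n hn).step j x = j')
    (hpos : o (i'.val = m - 1) (j'.val = n - 1) →
      (fun s => (YC p hp).step s x) '' S ∪ {⟨0, hp⟩} = T)
    (hneg : ¬ o (i'.val = m - 1) (j'.val = n - 1) → (fun s => (YC p hp).step s x) '' S = T) :
    (boolCatDFA hm hn hp o).step ((i, j), S) x = ((i', j'), T) := by
  subst hi hj
  have hacc : ((prodDFA (YA m hm) (YB n hn) o).step (i, j) x ∈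
      (prodDFA (YA m hm) (YB n hn) o).accept) =
      o (((YA m hm).step i x).val = m - 1) (((YB n hn).step j x).val = n - 1) := by
    change o (_ = _) (_ = _) = o _ _
    rw [Fin.ext_iff, Fin.ext_iff]
    rfl
  simp only [boolCatDFA, catDFA]
  rw [hacc]
  split_ifs with hF
  · exact Prod.ext rfl (hpos hF)
  · exact Prod.ext rfl (hneg hF)

theorem boolCatDFA_valid {m n p : ℕ} (hm : 2 ≤ m) (hn : 2 ≤ n) (hp : 0 < p)
    (o : Prop → Prop → Prop) (ho : ¬ o False False) (w : List ABC) :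
    ∀ i j S, (boolCatDFA (m := m) (n := n) (by omega) (by omega) hp o).eval w = ((i, j), S) →
      o (i.val = m - 1) (j.val = n - 1) → (⟨0, hp⟩ : Fin p) ∈ S := by
  induction w using List.reverseRecOn with
  | nil =>
    intro i j S h hF
    have h' := congrArg Prod.fst h
    have hi : i = ⟨0, by omega⟩ := (congrArg Prod.fst h').symm
    have hj : j = ⟨0, by omega⟩ := (congrArg Prod.snd h').symm
    subst hi hj
    simp only [show ¬ 0 = m - 1 by omega, show ¬ 0 = n - 1 by omega] at hF
    exact absurd hF ho
  | append_singleton w x _ =>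
    intro i j S h hF
    rw [DFA.eval_append_singleton] at h
    generalize (boolCatDFA (m := m) (n := n) (by omega) (by omega) hp o).eval w = q at h
    obtain ⟨⟨i', j'⟩, S'⟩ := q
    have h' := congrArg Prod.fst h
    have hi := congrArg Prod.fst h'
    have hj := congrArg Prod.snd h'
    rw [boolCatDFA_step_eq _ _ _ o i' j' S' (_ ∪ {⟨0, hp⟩}) x i j hi hj (fun _ => rfl)
      (absurd hF)] at h
    obtain ⟨-, rfl⟩ := Prod.mk.inj h
    exact Or.inr rfl

/-- Reachability in `boolCatDFA`, with the first two components read as natural numbers. -/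
def BoolCatReach (m n p : ℕ) (hm : 0 < m) (hn : 0 < n) (hp : 0 < p) (o : Prop → Prop → Prop)
    (i j : ℕ) (S : Set (Fin p)) : Prop :=
  ∃ (hi : i < m) (hj : j < n) (w : List ABC),
    (boolCatDFA hm hn hp o).eval w = ((⟨i, hi⟩, ⟨j, hj⟩), S)

theorem BoolCatReach.step {m n p : ℕ} {hm : 0 < m} {hn : 0 < n} {hp : 0 < p}
    {o : Prop → Prop → Prop} {i j : ℕ} {S : Set (Fin p)}
    (h : BoolCatReach m n p hm hn hp o i j S) (x : ABC) {i' j' : ℕ} (hi' : i' < m) (hj' : j' < n)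
    {T : Set (Fin p)}
    (hi : ∀ hi, (YA m hm).step ⟨i, hi⟩ x = ⟨i', hi'⟩)
    (hj : ∀ hj, (YB n hn).step ⟨j, hj⟩ x = ⟨j', hj'⟩)
    (hpos : o (i' = m - 1) (j' = n - 1) → (fun s => (YC p hp).step s x) '' S ∪ {⟨0, hp⟩} = T)
    (hneg : ¬ o (i' = m - 1) (j' = n - 1) → (fun s => (YC p hp).step s x) '' S = T) :
    BoolCatReach m n p hm hn hp o i' j' T := by
  obtain ⟨hi₀, hj₀, w, hw⟩ := h
  refine ⟨hi', hj', w ++ [x], ?_⟩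
  rw [DFA.eval_append_singleton, hw]
  exact boolCatDFA_step_eq hm hn hp o _ _ S T x _ _ (hi _) (hj _) hpos hneg

theorem BoolCatReach.valid {m n p : ℕ} {hm : 2 ≤ m} {hn : 2 ≤ n} {hp : 0 < p}
    {o : Prop → Prop → Prop} (ho : ¬ o False False) {i j : ℕ} {S : Set (Fin p)}
    (h : BoolCatReach m n p (by omega) (by omega) hp o i j S) (hF : o (i = m - 1) (j = n - 1)) :
    (⟨0, hp⟩ : Fin p) ∈ S := by
  obtain ⟨hi₀, hj₀, w, hw⟩ := h
  exact boolCatDFA_valid hm hn hp o ho w _ _ S hw hF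

theorem union_singleton_eq_of_mem {α : Type*} {S : Set α} {a : α} (h : a ∈ S) : S ∪ {a} = S :=
  Set.union_eq_left.2 (Set.singleton_subset_iff.2 h)

theorem reachRules_boolCatReach (m n p : ℕ) (hm : 3 ≤ m) (hn : 3 ≤ n) (hp : 3 ≤ p)
    (o : Prop → Prop → Prop) (ho : ¬ o False False)
    (ho' : o True False ∨ o True True) :
    ReachRules m n p hp (fun i j => o (i = m - 1) (j = n - 1))
      (BoolCatReach m n p (pos_of_three_le hm) (pos_of_three_le hn) (pos_of_three_le hp) o) where
  three_le_left := hm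
  three_le_right := hn
  not_final i j hi hj := by
    simpa only [show ¬ i = m - 1 by omega, show ¬ j = n - 1 by omega] using ho
  final_last := by
    simpa only [show ¬ 0 = n - 1 by omega] using ho'
  final_left j := by
    simp only [show ¬ 0 = m - 1 by omega, show ¬ 1 = m - 1 by omega]
  final_right i := by
    simp only [show ¬ 0 = n - 1 by omega, show ¬ 1 = n - 1 by omega]
  start := by
    refine ⟨by omega, by omega, [], Prod.ext rfl (if_neg fun h => ho ?_)⟩
    change o (_ = _) (_ = _) at h
    rw [Fin.ext_iff, Fin.ext_iff] at h
    change o (0 = m - 1) (0 = n - 1) at h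
    simpa only [show ¬ 0 = m - 1 by omega, show ¬ 0 = n - 1 by omega] using h
  swap_right i S := by
    have hne0 : ¬ 0 = n - 1 := by omega
    have hne1 : ¬ 1 = n - 1 := by omega
    have himg : (fun s => (YC p (by omega)).step s ABC.c) '' S = S := Set.image_id S
    constructor <;> intro h
    · have hv := h.valid (hm := by omega) (hn := by omega) ho
      refine h.step ABC.c h.1 (by omega) (fun _ => rfl) (fun _ => ?_) (fun hF => ?_)
        (fun _ => himg)
      · simp [YB, brzDFA, transp, Nat.mod_eq_of_lt (show 1 < n by omega)]
      · rw [himg]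
        simp only [hne0, hne1] at hF hv
        exact union_singleton_eq_of_mem (hv hF)
    · have hv := h.valid (hm := by omega) (hn := by omega) ho
      refine h.step ABC.c h.1 (by omega) (fun _ => rfl) (fun _ => ?_) (fun hF => ?_)
        (fun _ => himg)
      · simp [YB, brzDFA, transp]
      · rw [himg]
        simp only [hne0, hne1] at hF hv
        exact union_singleton_eq_of_mem (hv hF)
  swap_left j S hv h1 h := by
    have himg : (fun s => (YC p (by omega)).step s ABC.b) '' S = S :=
      contr_image_of_notMem (by omega) h1
    refine h.step ABC.b (by omega) h.2.1 (fun _ => ?_) (fun _ => rfl) (fun hF => ?_)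
      (fun _ => himg)
    · simp [YA, brzDFA, transp]
    · rw [himg]
      simp only [show ¬ 0 = m - 1 by omega, show ¬ 1 = m - 1 by omega] at hF hv
      exact union_singleton_eq_of_mem (hv hF)
  rotate i j i' j' S hi hj hv h := by
    subst hi hj
    have himg : (fun s => (YC p (by omega)).step s ABC.a) '' (cyc ⁻¹' S) = S :=
      Set.image_preimage_eq S cyc_bijective.2
    refine h.step ABC.a (Nat.mod_lt _ (by omega)) (Nat.mod_lt _ (by omega)) (fun _ => rfl)
      (fun _ => rfl) (fun hF => ?_) (fun _ => himg)
    rw [himg]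
    exact union_singleton_eq_of_mem (hv hF)
  insert i j i' j' S hi hj hF h0 h := by
    subst hi hj
    have himg : (fun s => (YC p (by omega)).step s ABC.a) '' (cyc ⁻¹' (S \ {⟨0, by omega⟩})) =
        S \ {⟨0, by omega⟩} :=
      Set.image_preimage_eq _ cyc_bijective.2
    refine h.step ABC.a (Nat.mod_lt _ (by omega)) (Nat.mod_lt _ (by omega)) (fun _ => rfl)
      (fun _ => rfl) (fun _ => ?_) (absurd hF)
    rw [himg]
    exact Set.sdiff_union_of_subset (Set.singleton_subset_iff.2 h0)

theorem statement15 (m n p : ℕ) (hm : 3 ≤ m) (hn : 3 ≤ n) (hp : 3 ≤ p)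
    (o : Prop → Prop → Prop) (ho : o = Or ∨ o = And ∨ o = Xor')
    (i : Fin m) (j : Fin n) (S : Set (Fin p)) :
    (∃ w : List ABC,
        (catDFA (prodDFA (YA m (by omega)) (YB n (by omega)) o) (YC p (by omega))).evalFrom
          (catDFA (prodDFA (YA m (by omega)) (YB n (by omega)) o) (YC p (by omega))).start w
        = ((i, j), S)) ↔
      (o (i.val = m - 1) (j.val = n - 1) → (⟨0, by omega⟩ : Fin p) ∈ S) := by
  have ho₁ : ¬ o False False := by
    rcases ho with rfl | rfl | rfl <;> simp [Xor']
  have ho₂ : o True False ∨ o True True := by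
    rcases ho with rfl | rfl | rfl <;> simp [Xor']
  constructor
  · rintro ⟨w, hw⟩ hF
    exact boolCatDFA_valid (by omega) (by omega) (by omega) o ho₁ w i j S hw hF
  · intro hv
    obtain ⟨_, _, w, hw⟩ := (reachRules_boolCatReach m n p hm hn hp o ho₁ ho₂).reach _ i.val j.val S
      i.isLt j.isLt hv rfl
    exact ⟨w, hw⟩
end

section
/- Let m,n,p ≥ 3 and, over the two-letter alphabet {a,b}, let K₁ = L(X_m(a,b,−;∅)), K₂ = L(X_n(a,−,b;∅)), K₃ = L(X_p(b,a,−;∅)). Then for every boolean operation ∘ among union, intersection and symmetric difference, the state complexity of (K₁·K₂) ∘ K₃ equals ((m−1)·2^n + 2^{n−1})·p. -/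
/-- The two-letter alphabet `{a,b}`. -/
inductive Two | a | b

/-- `X_m(a,b,−;∅)`: `a` the cycle, `b` the transposition. -/
def ZA (m : ℕ) (hm : 0 < m) : DFA Two (Fin m) :=
  brzDFA m hm (fun x q => match x with | Two.a => cyc q | Two.b => transp q)

/-- `X_n(a,−,b;∅)`: `a` the cycle, `b` the contraction. -/
def ZB (n : ℕ) (hn : 0 < n) : DFA Two (Fin n) :=
  brzDFA n hn (fun x q => match x with | Two.a => cyc q | Two.b => contr q)

/-- `X_p(b,a,−;∅)`: `b` the cycle, `a` the transposition. -/
def ZC (p : ℕ) (hp : 0 < p) : DFA Two (Fin p) :=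
  brzDFA p hp (fun x q => match x with | Two.a => transp q | Two.b => cyc q)

namespace DFA

/-- The sub-automaton of `M` on a set of states that is closed under the steps of `M` and
contains its start state. -/
def restrict {α σ : Type*} (M : DFA α σ) (R : Set σ) (hstart : M.start ∈ R)
    (hstep : ∀ s ∈ R, ∀ x, M.step s x ∈ R) : DFA α R where
  step s x := ⟨M.step s x, hstep s s.2 x⟩
  start := ⟨M.start, hstart⟩
  accept := {s | s.1 ∈ M.accept}

theorem accepts_restrict {α σ : Type*} (M : DFA α σ) (R : Set σ) (hstart : M.start ∈ R)
    (hstep : ∀ s ∈ R, ∀ x, M.step s x ∈ R) :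
    (M.restrict R hstart hstep).accepts = M.accepts := by
  have heval (w : List α) : ((M.restrict R hstart hstep).eval w).1 = M.eval w := by
    induction w using List.reverseRecOn with
    | nil => rfl
    | append_singleton w x ih => rw [eval_append_singleton, eval_append_singleton, ← ih]; rfl
  ext w
  rw [mem_accepts, mem_accepts, ← heval]
  rfl

theorem acceptsFrom_step_eq {α σ : Type*} {M : DFA α σ} {s t : σ}
    (h : M.acceptsFrom s = M.acceptsFrom t) (x : α) :
    M.acceptsFrom (M.step s x) = M.acceptsFrom (M.step t x) := by
  ext w
  exact Set.ext_iff.1 h (x :: w)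

theorem mem_accept_iff_of_acceptsFrom_eq {α σ : Type*} {M : DFA α σ} {s t : σ}
    (h : M.acceptsFrom s = M.acceptsFrom t) : s ∈ M.accept ↔ t ∈ M.accept :=
  Set.ext_iff.1 h []

theorem acceptsFrom_iterate_eq {α σ : Type*} {M : DFA α σ} {g : σ → σ}
    (hg : ∀ s t, M.acceptsFrom s = M.acceptsFrom t → M.acceptsFrom (g s) = M.acceptsFrom (g t))
    (j : ℕ) {s t : σ} (h : M.acceptsFrom s = M.acceptsFrom t) :
    M.acceptsFrom (g^[j] s) = M.acceptsFrom (g^[j] t) := by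
  induction j with
  | zero => exact h
  | succ j ih =>
    rw [Function.iterate_succ_apply', Function.iterate_succ_apply']
    exact hg _ _ ih

end DFA

/-- The state complexity of the language of a DFA is the number of its reachable states,
provided that these are pairwise distinguishable. -/
theorem sc_accepts_eq_ncard {α σ : Type} [Finite σ] (M : DFA α σ) (R : Set σ)
    (hR : ∀ s, s ∈ R ↔ ∃ w, M.eval w = s)
    (hdist : ∀ s t, M.acceptsFrom s = M.acceptsFrom t → s = t) :
    sc M.accepts = R.ncard := by
  have hstart : M.start ∈ R := (hR _).2 ⟨[], rfl⟩
  have hstep : ∀ s ∈ R, ∀ x, M.step s x ∈ R := by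
    intro s hs x
    obtain ⟨w, rfl⟩ := (hR s).1 hs
    exact (hR _).2 ⟨w ++ [x], M.eval_append_singleton w x⟩
  have hleast : IsLeast {n | ∃ N : DFA α (Fin n), N.accepts = M.accepts} R.ncard := by
    constructor
    · refine ⟨DFA.reindex (Finite.equivFinOfCardEq (Nat.card_coe_set_eq R))
        (M.restrict R hstart hstep), ?_⟩
      rw [DFA.accepts_reindex, DFA.accepts_restrict]
    · rintro k ⟨N, hN⟩
      choose w hw using fun s : R => (hR s).1 s.2
      have hinj : Function.Injective fun s : R => N.eval (w s) := by
        intro s t hst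
        refine Subtype.ext (hdist _ _ ?_)
        ext v
        have key (r : R) : v ∈ M.acceptsFrom r ↔ v ∈ N.acceptsFrom (N.eval (w r)) := by
          have h : w r ++ v ∈ N.accepts ↔ w r ++ v ∈ M.accepts := by rw [hN]
          rw [DFA.mem_accepts, DFA.mem_accepts, DFA.eval, DFA.eval] at h
          rw [DFA.evalFrom_of_append, DFA.evalFrom_of_append] at h
          rw [← hw r]
          exact h.symm
        rw [key, key]
        exact iff_of_eq (congrArg (fun q => v ∈ N.acceptsFrom q) hst)
      have := Nat.card_le_card_of_injective _ hinj
      rwa [Nat.card_coe_set_eq, Nat.card_fin] at this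
  exact hleast.csInf_eq

/-- The subset-construction automaton for `(L(A) · L(B)) ∘ L(C)`, where `f` is the truth
function of `∘`. A state records the state of `A`, the set of states of `B` reachable after
some factor accepted by `A`, and the state of `C`. -/
def catBoolDFA {α σ₁ σ₂ σ₃ : Type*} (A : DFA α σ₁) (B : DFA α σ₂) (C : DFA α σ₃)
    (f : Prop → Prop → Prop) : DFA α (σ₁ × Set σ₂ × σ₃) where
  step s x := (A.step s.1 x,
    {q | (∃ r ∈ s.2.1, B.step r x = q) ∨ (A.step s.1 x ∈ A.accept ∧ q = B.start)},
    C.step s.2.2 x)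
  start := (A.start, {q | A.start ∈ A.accept ∧ q = B.start}, C.start)
  accept := {s | f (∃ q ∈ s.2.1, q ∈ B.accept) (s.2.2 ∈ C.accept)}

section CatBool

variable {α σ₁ σ₂ σ₃ : Type*} (A : DFA α σ₁) (B : DFA α σ₂) (C : DFA α σ₃)
  (f : Prop → Prop → Prop)

theorem eval_catBoolDFA (w : List α) :
    (catBoolDFA A B C f).eval w =
      (A.eval w, {q | ∃ u ∈ A.accepts, ∃ v, B.eval v = q ∧ u ++ v = w}, C.eval w) := by
  induction w using List.reverseRecOn with
  | nil =>
    refine Prod.ext rfl (Prod.ext ?_ rfl)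
    ext q
    constructor
    · rintro ⟨h, rfl⟩
      exact ⟨[], h, [], rfl, rfl⟩
    · rintro ⟨u, hu, v, rfl, huv⟩
      obtain ⟨rfl, rfl⟩ := List.append_eq_nil_iff.1 huv
      exact ⟨hu, rfl⟩
  | append_singleton w x ih =>
    rw [DFA.eval_append_singleton, ih, DFA.eval_append_singleton, DFA.eval_append_singleton]
    refine Prod.ext rfl (Prod.ext ?_ rfl)
    ext q
    constructor
    · rintro (⟨r, ⟨u, hu, v, rfl, rfl⟩, rfl⟩ | ⟨h, rfl⟩)
      · exact ⟨u, hu, v ++ [x], B.eval_append_singleton v x, (List.append_assoc ..).symm⟩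
      · refine ⟨w ++ [x], ?_, [], rfl, List.append_nil _⟩
        rwa [DFA.mem_accepts, DFA.eval_append_singleton]
    · rintro ⟨u, hu, v, rfl, huv⟩
      rcases List.eq_nil_or_concat' v with rfl | ⟨v, y, rfl⟩
      · rw [List.append_nil] at huv
        rw [huv, DFA.mem_accepts, DFA.eval_append_singleton] at hu
        exact Or.inr ⟨hu, rfl⟩
      · rw [← List.append_assoc] at huv
        obtain ⟨rfl, h⟩ := List.append_inj' huv rfl
        obtain rfl := List.singleton_injective h
        exact Or.inl ⟨_, ⟨u, hu, v, rfl, rfl⟩, (B.eval_append_singleton v y).symm⟩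

theorem mem_accepts_catBoolDFA (w : List α) :
    w ∈ (catBoolDFA A B C f).accepts ↔ f (w ∈ A.accepts * B.accepts) (w ∈ C.accepts) := by
  rw [DFA.mem_accepts, eval_catBoolDFA]
  have h : (∃ q ∈ {q | ∃ u ∈ A.accepts, ∃ v, B.eval v = q ∧ u ++ v = w}, q ∈ B.accept) ↔
      w ∈ A.accepts * B.accepts := by
    rw [Language.mem_mul]
    constructor
    · rintro ⟨_, ⟨u, hu, v, rfl, huv⟩, hq⟩
      exact ⟨u, hu, v, hq, huv⟩
    · rintro ⟨u, hu, v, hv, huv⟩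
      exact ⟨_, ⟨u, hu, v, rfl, huv⟩, hv⟩
  exact iff_of_eq (congrArg₂ f (propext h) rfl)

end CatBool

theorem val_cyc {n : ℕ} (i : Fin n) :
    (cyc i).val = if i.val + 1 = n then 0 else i.val + 1 := by
  have := i.isLt
  split_ifs with h
  · simp [cyc, h]
  · exact Nat.mod_eq_of_lt (by omega)

theorem val_transp {n : ℕ} (hn : 2 ≤ n) (i : Fin n) :
    (transp i).val = if i.val = 0 then 1 else if i.val = 1 then 0 else i.val := by
  unfold transp
  split_ifs
  · exact Nat.mod_eq_of_lt hn
  · rfl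
  · rfl

theorem val_contr {n : ℕ} (i : Fin n) :
    (contr i).val = if i.val = 1 then 0 else i.val := by
  unfold contr
  split_ifs <;> rfl

theorem cyc_injective {n : ℕ} : Function.Injective (cyc : Fin n → Fin n) := by
  intro i j h
  have h := congrArg Fin.val h
  rw [val_cyc, val_cyc] at h
  ext
  split_ifs at h <;> omega

theorem transp_injective {n : ℕ} (hn : 2 ≤ n) :
    Function.Injective (transp : Fin n → Fin n) := by
  intro i j h
  have h := congrArg Fin.val h
  rw [val_transp hn, val_transp hn] at h
  ext
  split_ifs at h <;> omega

theorem cyc_surjective {n : ℕ} : Function.Surjective (cyc : Fin n → Fin n) :=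
  Finite.surjective_of_injective cyc_injective

theorem transp_surjective {n : ℕ} (hn : 2 ≤ n) :
    Function.Surjective (transp : Fin n → Fin n) :=
  Finite.surjective_of_injective (transp_injective hn)

theorem image_contr_image_transp {n : ℕ} (hn : 2 ≤ n) {T : Set (Fin n)}
    (hT : ∀ q ∈ T, q.val ≠ 1) : contr '' (transp '' T) = T := by
  have h : ∀ q ∈ T, contr (transp q) = q := by
    intro q hq
    have := hT q hq
    ext
    rw [val_contr, val_transp hn]
    split_ifs <;> omega
  rw [Set.image_image, Set.image_congr h, Set.image_id']

/-- Along an injective self-map of a finite type, a point that is reached is reached again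
after arbitrarily many steps. -/
theorem exists_ge_iterate_eq {ι : Type*} [Finite ι] {h : ι → ι} (hh : Function.Injective h)
    {x y : ι} (hxy : ∃ j, h^[j] x = y) (N : ℕ) : ∃ j ≥ N, h^[j] x = y := by
  obtain ⟨j, rfl⟩ := hxy
  obtain ⟨q, hq, hper⟩ := hh.mem_periodicPts x
  refine ⟨j + q * N, ?_, ?_⟩
  · have := Nat.le_mul_of_pos_left N hq
    omega
  · rw [Function.iterate_add_apply, (hper.mul_const N).eq]

/-- A self-map of `Fin n` that increments the values in `[x, y)` leads from `x` to `y`. -/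
theorem exists_iterate_eq_of_succ {n : ℕ} {h : Fin n → Fin n} {x y : Fin n}
    (hxy : x.val ≤ y.val)
    (hsucc : ∀ z : Fin n, x.val ≤ z.val → z.val < y.val → (h z).val = z.val + 1) :
    ∃ j, h^[j] x = y := by
  have key : ∀ d, x.val + d ≤ y.val → (h^[d] x).val = x.val + d := by
    intro d
    induction d with
    | zero => intro _; rfl
    | succ d ih =>
      intro hd
      have ih := ih (by omega)
      rw [Function.iterate_succ_apply', hsucc _ (by omega) (by omega), ih]
      omega
  refine ⟨y.val - x.val, Fin.ext ?_⟩
  rw [key _ (by omega)]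
  omega

theorem exists_iterate_cyc_eq {n : ℕ} (x y : Fin n) : ∃ j, cyc^[j] x = y := by
  have hx := x.isLt
  have hn : 0 < n := by omega
  obtain ⟨i, hi⟩ := exists_iterate_eq_of_succ (h := cyc) (x := x) (y := ⟨n - 1, by omega⟩)
    (Nat.le_sub_one_of_lt hx) (by
      intro z _ hz
      rw [val_cyc, if_neg (by dsimp only at hz; omega)])
  obtain ⟨j, hj⟩ := exists_iterate_eq_of_succ (h := cyc) (x := ⟨0, hn⟩) (y := y)
    (Nat.zero_le _) (by
      intro z _ hz
      rw [val_cyc, if_neg (by omega)])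
  refine ⟨j + (1 + i), ?_⟩
  rw [Function.iterate_add_apply, Function.iterate_add_apply, hi, Function.iterate_one,
    show cyc (⟨n - 1, by omega⟩ : Fin n) = ⟨0, hn⟩ from
      Fin.ext (by rw [val_cyc, if_pos (by dsimp only; omega)]), hj]

/-- The orbit of `cyc ∘ transp` on the points other than `1` contains `n - 1`. -/
theorem exists_iterate_cyc_transp_eq {n : ℕ} (hn : 2 < n) {x y : Fin n} (hx : x.val ≠ 1)
    (hy : y.val = n - 1) : ∃ j, (fun i : Fin n => cyc (transp i))^[j] x = y := by
  have hval (z : Fin n) : (cyc (transp z)).val =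
      if z.val = 0 then 2 else if z.val = 1 then 1 else
        if z.val + 1 = n then 0 else z.val + 1 := by
    rw [val_cyc, val_transp (by omega)]
    split_ifs <;> omega
  have large (z : Fin n) (hz : 2 ≤ z.val) :
      ∃ j, (fun i : Fin n => cyc (transp i))^[j] z = y := by
    refine exists_iterate_eq_of_succ (by omega) fun u hu hu' => ?_
    rw [hval, if_neg (by omega), if_neg (by omega), if_neg (by omega)]
  by_cases h : x.val = 0
  · have h2 : (cyc (transp x)).val = 2 := by
      rw [hval, if_pos h]
    obtain ⟨j, hj⟩ := large (cyc (transp x)) h2.ge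
    exact ⟨j + 1, hj⟩
  · exact large x (by omega)

/-- The orbit of `transp ∘ cyc` on the points other than `0` contains `n - 2`. -/
theorem exists_iterate_transp_cyc_eq {n : ℕ} (hn : 2 < n) {x y : Fin n} (hx : x.val ≠ 0)
    (hy : y.val = n - 2) : ∃ j, (fun i : Fin n => transp (cyc i))^[j] x = y := by
  have small (z : Fin n) (hz : 1 ≤ z.val) (hz' : z.val ≤ n - 2) :
      ∃ j, (fun i : Fin n => transp (cyc i))^[j] z = y := by
    refine exists_iterate_eq_of_succ (by omega) fun u hu hu' => ?_
    have hc : (cyc u).val = u.val + 1 := by rw [val_cyc, if_neg (by omega)]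
    rw [val_transp (by omega), hc, if_neg (by omega), if_neg (by omega)]
  by_cases h : x.val = n - 1
  · have h1 : (transp (cyc x)).val = 1 := by
      rw [val_transp (by omega), val_cyc]
      split_ifs <;> omega
    obtain ⟨j, hj⟩ := small (transp (cyc x)) h1.ge (by omega)
    exact ⟨j + 1, hj⟩
  · exact small x (by omega) (by have := x.isLt; omega)

theorem val_transp_iterate_last {p : ℕ} (hp : 2 < p) (j : ℕ) {k : Fin p} :
    (transp^[j] k).val = p - 1 ↔ k.val = p - 1 := by
  have hfix : transp (⟨p - 1, by omega⟩ : Fin p) = ⟨p - 1, by omega⟩ := by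
    ext
    rw [val_transp (by omega), if_neg (by dsimp only; omega), if_neg (by dsimp only; omega)]
  have h (k : Fin p) : k.val = p - 1 ↔ k = ⟨p - 1, by omega⟩ := ⟨fun h => Fin.ext h, fun h => congrArg Fin.val h⟩
  rw [h, h]
  conv_lhs => rw [← Function.iterate_fixed hfix j]
  exact ((transp_injective (by omega)).iterate j).eq_iff

/-- The automaton for `(L(ZA m) · L(ZB n)) ∘ L(ZC p)`. -/
def zDFA (m n p : ℕ) (hm : 2 < m) (hn : 2 < n) (hp : 2 < p) (f : Prop → Prop → Prop) :
    DFA Two (Fin m × Set (Fin n) × Fin p) :=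
  catBoolDFA (ZA m (by omega)) (ZB n (by omega)) (ZC p (by omega)) f

section ZDFA

variable {m n p : ℕ} (hm : 2 < m) (hn : 2 < n) (hp : 2 < p) (f : Prop → Prop → Prop)

theorem zDFA_step_a (s : Fin m × Set (Fin n) × Fin p) :
    (zDFA m n p hm hn hp f).step s Two.a =
      (cyc s.1, cyc '' s.2.1 ∪ {q | (cyc s.1).val = m - 1 ∧ q.val = 0}, transp s.2.2) := by
  refine Prod.ext rfl (Prod.ext ?_ rfl)
  ext q
  exact or_congr Iff.rfl (and_congr Fin.ext_iff Fin.ext_iff)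

theorem zDFA_step_b (s : Fin m × Set (Fin n) × Fin p) :
    (zDFA m n p hm hn hp f).step s Two.b =
      (transp s.1, contr '' s.2.1 ∪ {q | (transp s.1).val = m - 1 ∧ q.val = 0},
        cyc s.2.2) := by
  refine Prod.ext rfl (Prod.ext ?_ rfl)
  ext q
  exact or_congr Iff.rfl (and_congr Fin.ext_iff Fin.ext_iff)

theorem mem_accept_zDFA {s : Fin m × Set (Fin n) × Fin p} :
    s ∈ (zDFA m n p hm hn hp f).accept ↔
      f (∃ q ∈ s.2.1, q.val = n - 1) (s.2.2.val = p - 1) := by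
  have h₁ : (∃ q ∈ s.2.1, q ∈ (ZB n (by omega)).accept) ↔ ∃ q ∈ s.2.1, q.val = n - 1 :=
    exists_congr fun q => and_congr Iff.rfl Fin.ext_iff
  have h₂ : s.2.2 ∈ (ZC p (by omega)).accept ↔ s.2.2.val = p - 1 := Fin.ext_iff
  exact iff_of_eq (congrArg₂ f (propext h₁) (propext h₂))

theorem zDFA_start :
    (zDFA m n p hm hn hp f).start = (⟨0, by omega⟩, ∅, ⟨0, by omega⟩) := by
  refine Prod.ext rfl (Prod.ext ?_ rfl)
  refine Set.eq_empty_of_forall_notMem fun q hq => ?_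
  have h : (0 : ℕ) = m - 1 := Fin.ext_iff.1 hq.1
  omega

/-! ### Reachable states -/

/-- All states with first components `i` and `S` are reachable. -/
def ReachAll (i : Fin m) (S : Set (Fin n)) : Prop :=
  ∀ k : Fin p, ∃ w, (zDFA m n p hm hn hp f).eval w = (i, S, k)

variable {hm hn hp f}

theorem exists_eval_step {s : Fin m × Set (Fin n) × Fin p} (x : Two)
    (h : ∃ w, (zDFA m n p hm hn hp f).eval w = s) :
    ∃ w, (zDFA m n p hm hn hp f).eval w = (zDFA m n p hm hn hp f).step s x := by
  obtain ⟨w, rfl⟩ := h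
  exact ⟨w ++ [x], DFA.eval_append_singleton _ w x⟩

theorem ReachAll.step_a {i : Fin m} {S : Set (Fin n)} (h : ReachAll hm hn hp f i S) :
    ReachAll hm hn hp f (cyc i) (cyc '' S ∪ {q | (cyc i).val = m - 1 ∧ q.val = 0}) := by
  intro k
  obtain ⟨k, rfl⟩ := transp_surjective (by omega) k
  simpa only [zDFA_step_a] using exists_eval_step Two.a (h k)

theorem ReachAll.step_b {i : Fin m} {S : Set (Fin n)} (h : ReachAll hm hn hp f i S) :
    ReachAll hm hn hp f (transp i)
      (contr '' S ∪ {q | (transp i).val = m - 1 ∧ q.val = 0}) := by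
  intro k
  obtain ⟨k, rfl⟩ := cyc_surjective k
  simpa only [zDFA_step_b] using exists_eval_step Two.b (h k)

theorem ReachAll.cyc {i j : Fin m} {T : Set (Fin n)}
    (h : ReachAll hm hn hp f i (_root_.cyc ⁻¹' T)) (hij : _root_.cyc i = j)
    (hj : j.val = m - 1 → ∀ q : Fin n, q.val = 0 → q ∈ T) : ReachAll hm hn hp f j T := by
  subst hij
  have := h.step_a
  rwa [Set.image_preimage_eq _ cyc_surjective, Set.union_eq_left.2 fun q hq => hj hq.1 q hq.2]
    at this

theorem ReachAll.contr {i j : Fin m} {S T : Set (Fin n)} (h : ReachAll hm hn hp f i S)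
    (hST : _root_.contr '' S = T) (hij : transp i = j) (hj : j.val ≠ m - 1) :
    ReachAll hm hn hp f j T := by
  subst hij
  have := h.step_b
  rwa [hST, Set.union_eq_left.2 fun q hq => absurd hq.1 hj] at this

theorem reachAll_of_zero {T : Set (Fin n)}
    (h : ∀ j : ℕ, ReachAll hm hn hp f ⟨0, by omega⟩ (cyc^[j] ⁻¹' T))
    {i : Fin m} (hi : i.val < m - 1) : ReachAll hm hn hp f i T := by
  have key : ∀ d (hd : d < m - 1) (j : ℕ),
      ReachAll hm hn hp f ⟨d, by omega⟩ (cyc^[j] ⁻¹' T) := by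
    intro d
    induction d with
    | zero => exact fun _ => h
    | succ d ih =>
      intro hd j
      have := ih (by omega) (j + 1)
      rw [Function.iterate_succ, Set.preimage_comp] at this
      refine this.cyc (Fin.ext ?_) fun h => absurd h (by dsimp only; omega)
      rw [val_cyc, if_neg (by dsimp only; omega)]
  exact key i hi 0

theorem reachAll_empty {i : Fin m} (hi : i.val < m - 1) : ReachAll hm hn hp f i ∅ := by
  have b {i j : Fin m} {k l : Fin p} (h : ∃ w, (zDFA m n p hm hn hp f).eval w = (i, ∅, k))
      (hij : transp i = j) (hj : j.val ≠ m - 1) (hkl : cyc k = l) :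
      ∃ w, (zDFA m n p hm hn hp f).eval w = (j, ∅, l) := by
    have h := exists_eval_step Two.b h
    simpa [zDFA_step_b, hij, hkl, hj] using h
  have t₀ : transp (⟨0, by omega⟩ : Fin m) = ⟨1, by omega⟩ :=
    Fin.ext (by rw [val_transp (by omega), if_pos rfl])
  have t₁ : transp (⟨1, by omega⟩ : Fin m) = ⟨0, by omega⟩ :=
    Fin.ext (by rw [val_transp (by omega), if_neg one_ne_zero, if_pos rfl])
  have c₀ : cyc (⟨0, by omega⟩ : Fin m) = ⟨1, by omega⟩ :=
    Fin.ext (by rw [val_cyc, if_neg (by dsimp only; omega)])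
  have start : ∃ w, (zDFA m n p hm hn hp f).eval w =
      (⟨0, by omega⟩, ∅, ⟨0, by omega⟩) := ⟨[], zDFA_start ..⟩
  have b₁ := b start t₀ (by dsimp only; omega) (l := ⟨1, by omega⟩)
    (Fin.ext (by rw [val_cyc, if_neg (by dsimp only; omega)]))
  have b₂ := b b₁ t₁ (by dsimp only; omega) (l := ⟨2, by omega⟩)
    (Fin.ext (by rw [val_cyc, if_neg (by dsimp only; omega)]))
  have a₂ : ∃ w, (zDFA m n p hm hn hp f).eval w =
      (⟨1, by omega⟩, ∅, ⟨2, by omega⟩) := by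
    have h := exists_eval_step Two.a b₂
    have h₂ : transp (⟨2, by omega⟩ : Fin p) = ⟨2, by omega⟩ :=
      Fin.ext (by rw [val_transp (by omega), if_neg two_ne_zero, if_neg (OfNat.ofNat_ne_one 2)])
    have hm' : 1 ≠ m - 1 := by omega
    simpa [zDFA_step_a, c₀, h₂, hm'] using h
  have both (k : Fin p) :
      (∃ w, (zDFA m n p hm hn hp f).eval w = (⟨0, by omega⟩, ∅, k)) ∧
      ∃ w, (zDFA m n p hm hn hp f).eval w = (⟨1, by omega⟩, ∅, k) := by
    obtain ⟨j, rfl⟩ := exists_iterate_cyc_eq ⟨2, by omega⟩ k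
    induction j with
    | zero => exact ⟨b₂, a₂⟩
    | succ j ih =>
      rw [Function.iterate_succ_apply']
      exact ⟨b ih.2 t₁ (by dsimp only; omega) rfl, b ih.1 t₀ (by dsimp only; omega) rfl⟩
  exact reachAll_of_zero (fun j k => (both k).1) hi

/-- The successor step of the induction on the size of the subset. -/
theorem reachAll_of_ncard {N : ℕ}
    (ih : ∀ (i : Fin m) (S : Set (Fin n)), S.ncard = N → i.val < m - 1 →
      ReachAll hm hn hp f i S)
    {i : Fin m} {T : Set (Fin n)} (hT : T.ncard = N + 1)
    (hi : i.val = m - 1 → ∀ q : Fin n, q.val = 0 → q ∈ T) : ReachAll hm hn hp f i T := by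
  have ncard_cyc (T : Set (Fin n)) : (cyc ⁻¹' T).ncard = T.ncard :=
    Set.ncard_preimage_of_injective_subset_range cyc_injective
      (by rw [cyc_surjective.range_eq]; exact Set.subset_univ T)
  have last (i : Fin m) (hi : i.val = m - 1) (T : Set (Fin n)) (hT : T.ncard = N + 1)
      (h0 : (⟨0, by omega⟩ : Fin n) ∈ T) : ReachAll hm hn hp f i T := by
    have h := ih ⟨m - 2, by omega⟩ (cyc ⁻¹' (T \ {⟨0, by omega⟩}))
      (by rw [ncard_cyc, Set.ncard_sdiff_singleton_of_mem h0, hT]; rfl)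
      (by dsimp only; omega)
    have hc : cyc (⟨m - 2, by omega⟩ : Fin m) = i := by
      ext
      rw [val_cyc, if_neg (by dsimp only; omega), hi]
      dsimp only
      omega
    have h := h.step_a
    rw [hc, Set.image_preimage_eq _ cyc_surjective] at h
    convert h using 1
    ext q
    by_cases hq : q.val = 0
    · have hq' : q = ⟨0, by omega⟩ := Fin.ext hq
      simp [hq', h0, hi]
    · have : q ≠ ⟨0, by omega⟩ := fun h => hq (congrArg Fin.val h)
      simp [hq, this]
  have zero_of_one (T : Set (Fin n)) (hT : T.ncard = N + 1)
      (h1 : (⟨1, by omega⟩ : Fin n) ∈ T) : ReachAll hm hn hp f ⟨0, by omega⟩ T := by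
    refine (last ⟨m - 1, by omega⟩ rfl (cyc ⁻¹' T) (by rw [ncard_cyc, hT]) ?_).cyc
      (Fin.ext ?_) ?_
    · have : cyc (⟨0, by omega⟩ : Fin n) = ⟨1, by omega⟩ :=
        Fin.ext (by rw [val_cyc, if_neg (by dsimp only; omega)])
      rwa [Set.mem_preimage, this]
    · rw [val_cyc, if_pos (by dsimp only; omega)]
    · intro h
      dsimp only at h
      omega
  have zero_of_pos (x : ℕ) : ∀ T : Set (Fin n), T.ncard = N + 1 →
      (∃ q ∈ T, q.val = x + 1) → ReachAll hm hn hp f ⟨0, by omega⟩ T := by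
    induction x with
    | zero =>
      rintro T hT ⟨q, hq, hq1⟩
      have hq' : q = ⟨1, by omega⟩ := Fin.ext hq1
      exact zero_of_one T hT (hq' ▸ hq)
    | succ x ihx =>
      rintro T hT ⟨q, hq, hqx⟩
      by_cases h1 : (⟨1, by omega⟩ : Fin n) ∈ T
      · exact zero_of_one T hT h1
      have h := ihx (cyc ⁻¹' (transp '' T))
        (by rw [ncard_cyc, Set.ncard_image_of_injective _ (transp_injective (by omega)), hT])
        ⟨⟨x + 1, by omega⟩, ⟨q, hq, Fin.ext ?_⟩, rfl⟩
      · refine (h.cyc (j := ⟨1, by omega⟩) (Fin.ext ?_) ?_).contr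
          (image_contr_image_transp (by omega) ?_) (Fin.ext ?_) ?_
        · rw [val_cyc, if_neg (by dsimp only; omega)]
        · intro h
          dsimp only at h
          omega
        · rintro q hq h
          have hq' : q = ⟨1, by omega⟩ := Fin.ext h
          exact h1 (hq' ▸ hq)
        · rw [val_transp (by omega), if_neg one_ne_zero, if_pos rfl]
        · dsimp only
          omega
      · have := q.isLt
        rw [val_transp (by omega), val_cyc]
        dsimp only
        split_ifs <;> omega
  have zero (T : Set (Fin n)) (hT : T.ncard = N + 1) :
      ReachAll hm hn hp f ⟨0, by omega⟩ T := by
    by_cases h : ∃ q ∈ T, q.val ≠ 0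
    · obtain ⟨q, hq, hq0⟩ := h
      exact zero_of_pos (q.val - 1) T hT ⟨q, hq, by omega⟩
    · push Not at h
      have hne : T.Nonempty := Set.nonempty_of_ncard_ne_zero (by omega)
      have hT0 : T = {⟨0, by omega⟩} :=
        Set.eq_singleton_iff_nonempty_unique_mem.2 ⟨hne, fun q hq => Fin.ext (h q hq)⟩
      rw [hT0] at hT ⊢
      have h1 := zero_of_one {⟨1, by omega⟩}
        (by rw [← hT, Set.ncard_singleton, Set.ncard_singleton]) rfl
      have h0 : ReachAll hm hn hp f ⟨1, by omega⟩ {⟨0, by omega⟩} := h1.contr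
        (by rw [Set.image_singleton]; rfl)
        (Fin.ext (by rw [val_transp (by omega), if_pos rfl])) (by dsimp only; omega)
      exact h0.contr (by rw [Set.image_singleton]; rfl)
        (Fin.ext (by rw [val_transp (by omega), if_neg one_ne_zero, if_pos rfl]))
        (by dsimp only; omega)
  by_cases him : i.val = m - 1
  · exact last i him T hT (hi him _ rfl)
  · refine reachAll_of_zero (fun j => zero _ ?_) (by omega)
    rw [Set.ncard_preimage_of_injective_subset_range (cyc_injective.iterate j), hT]
    rw [(cyc_surjective.iterate j).range_eq]
    exact Set.subset_univ T

theorem reachAll (i : Fin m) (T : Set (Fin n))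
    (hi : i.val = m - 1 → ∀ q : Fin n, q.val = 0 → q ∈ T) : ReachAll hm hn hp f i T := by
  generalize hN : T.ncard = N
  induction N generalizing i T with
  | zero =>
    obtain rfl := (Set.ncard_eq_zero (Set.toFinite T)).1 hN
    refine reachAll_empty ?_
    have h := fun h => hi h ⟨0, by omega⟩ rfl
    have := i.isLt
    by_contra h'
    exact h (by omega)
  | succ N ih =>
    exact reachAll_of_ncard (fun i S hS hi => ih i S (fun h => absurd h hi.ne) hS) hN hi

/-- The reachable states are those whose subset contains `0` as soon as the first factor is
accepted. -/
theorem exists_eval_zDFA_eq_iff (s : Fin m × Set (Fin n) × Fin p) :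
    (∃ w, (zDFA m n p hm hn hp f).eval w = s) ↔
      (s.1.val = m - 1 → ⟨0, by omega⟩ ∈ s.2.1) := by
  constructor
  · rintro ⟨w, rfl⟩
    rcases List.eq_nil_or_concat' w with rfl | ⟨w, x, rfl⟩
    · rw [DFA.eval_nil, zDFA_start]
      intro h
      dsimp only at h
      omega
    · rw [DFA.eval_append_singleton]
      cases x
      · rw [zDFA_step_a]
        exact fun h => Or.inr ⟨h, rfl⟩
      · rw [zDFA_step_b]
        exact fun h => Or.inr ⟨h, rfl⟩
  · intro h
    refine reachAll s.1 s.2.1 (fun hi q hq => ?_) s.2.2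
    have hq' : q = ⟨0, by omega⟩ := Fin.ext hq
    exact hq' ▸ h hi

/-! ### Distinguishable states -/

theorem mem_zDFA_step_a {s : Fin m × Set (Fin n) × Fin p} {q r : Fin n}
    (hqr : r.val = q.val + 1) :
    r ∈ ((zDFA m n p hm hn hp f).step s Two.a).2.1 ↔ q ∈ s.2.1 := by
  have hc : cyc q = r := by
    ext
    rw [val_cyc, if_neg (by omega), hqr]
  have hr : r.val ≠ 0 := by omega
  rw [zDFA_step_a, ← hc, Set.mem_union, cyc_injective.mem_set_image, hc]
  simp [hr]

theorem mem_zDFA_step_b {s : Fin m × Set (Fin n) × Fin p} {q : Fin n} (hq : 2 ≤ q.val) :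
    q ∈ ((zDFA m n p hm hn hp f).step s Two.b).2.1 ↔ q ∈ s.2.1 := by
  rw [zDFA_step_b]
  constructor
  · rintro (⟨r, hr, h⟩ | ⟨-, h : q.val = 0⟩)
    · have h := congrArg Fin.val h
      rw [val_contr] at h
      have hrq : r = q := by
        ext
        split_ifs at h <;> omega
      exact hrq ▸ hr
    · omega
  · intro h
    refine Or.inl ⟨q, h, Fin.ext ?_⟩
    rw [val_contr, if_neg (by omega)]

theorem nonempty_zDFA_step {s : Fin m × Set (Fin n) × Fin p} (hs : s.2.1.Nonempty) (x : Two) :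
    ((zDFA m n p hm hn hp f).step s x).2.1.Nonempty := by
  cases x
  · rw [zDFA_step_a]
    exact (hs.image _).inl
  · rw [zDFA_step_b]
    exact (hs.image _).inl

theorem mem_zDFA_iterate_step_a {q r : Fin n} {j : ℕ} (hqr : r.val = q.val + j)
    (s : Fin m × Set (Fin n) × Fin p) :
    r ∈ (((zDFA m n p hm hn hp f).step · Two.a)^[j] s).2.1 ↔ q ∈ s.2.1 := by
  induction j generalizing r with
  | zero =>
    rw [Fin.ext hqr]
    rfl
  | succ j ih =>
    rw [Function.iterate_succ_apply',
      mem_zDFA_step_a (q := ⟨r.val - 1, by omega⟩) (by dsimp only; omega)]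
    exact ih (by dsimp only; omega)

theorem mem_zDFA_iterate_step_b {q : Fin n} (hq : 2 ≤ q.val) (j : ℕ)
    (s : Fin m × Set (Fin n) × Fin p) :
    q ∈ (((zDFA m n p hm hn hp f).step · Two.b)^[j] s).2.1 ↔ q ∈ s.2.1 := by
  induction j with
  | zero => rfl
  | succ j ih => rw [Function.iterate_succ_apply', mem_zDFA_step_b hq, ih]

theorem zDFA_iterate_step_a_snd_snd {s : Fin m × Set (Fin n) × Fin p} (j : ℕ) :
    (((zDFA m n p hm hn hp f).step · Two.a)^[j] s).2.2 = transp^[j] s.2.2 :=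
  (Function.Semiconj.iterate_right (f := fun s : Fin m × Set (Fin n) × Fin p => s.2.2)
    (fun _ => rfl) j).eq s

theorem zDFA_iterate_step_b_snd_snd {s : Fin m × Set (Fin n) × Fin p} (j : ℕ) :
    (((zDFA m n p hm hn hp f).step · Two.b)^[j] s).2.2 = cyc^[j] s.2.2 :=
  (Function.Semiconj.iterate_right (f := fun s : Fin m × Set (Fin n) × Fin p => s.2.2)
    (fun _ => rfl) j).eq s

variable (hm hn hp f) in
/-- The action of the word `ab`, whose powers collapse every set of states of `ZB n` to a
subset of `{0}`. -/
def stepAB (s : Fin m × Set (Fin n) × Fin p) : Fin m × Set (Fin n) × Fin p :=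
  (zDFA m n p hm hn hp f).step ((zDFA m n p hm hn hp f).step s Two.a) Two.b

theorem iterate_stepAB_fst {s : Fin m × Set (Fin n) × Fin p} (j : ℕ) :
    ((stepAB hm hn hp f)^[j] s).1 = (fun i => transp (cyc i))^[j] s.1 :=
  (Function.Semiconj.iterate_right (f := fun s : Fin m × Set (Fin n) × Fin p => s.1)
    (fun _ => rfl) j).eq s

theorem iterate_stepAB_snd_snd {s : Fin m × Set (Fin n) × Fin p} (j : ℕ) :
    ((stepAB hm hn hp f)^[j] s).2.2 = (fun k => cyc (transp k))^[j] s.2.2 :=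
  (Function.Semiconj.iterate_right (f := fun s : Fin m × Set (Fin n) × Fin p => s.2.2)
    (fun _ => rfl) j).eq s

theorem nonempty_iterate_stepAB {s : Fin m × Set (Fin n) × Fin p} (hs : s.2.1.Nonempty)
    (j : ℕ) : ((stepAB hm hn hp f)^[j] s).2.1.Nonempty := by
  induction j with
  | zero => exact hs
  | succ j ih =>
    rw [Function.iterate_succ_apply']
    exact nonempty_zDFA_step (nonempty_zDFA_step ih _) _

theorem val_eq_zero_or_lt_of_mem_iterate_stepAB (j : ℕ) {s : Fin m × Set (Fin n) × Fin p}
    {q : Fin n} (hq : q ∈ ((stepAB hm hn hp f)^[j] s).2.1) : q.val = 0 ∨ j < q.val := by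
  induction j generalizing q with
  | zero => exact Nat.eq_zero_or_pos _
  | succ j ih =>
    rw [Function.iterate_succ_apply', stepAB] at hq
    have h1 : q.val ≠ 1 := by
      rw [zDFA_step_b] at hq
      rcases hq with ⟨r, -, rfl⟩ | ⟨-, h : q.val = 0⟩
      · rw [val_contr]
        split_ifs <;> omega
      · omega
    by_cases h0 : q.val = 0
    · exact Or.inl h0
    · rw [mem_zDFA_step_b (by omega),
        mem_zDFA_step_a (q := ⟨q.val - 1, by omega⟩) (by dsimp only; omega)] at hq
      have := ih hq
      dsimp only at this
      omega

theorem val_eq_zero_of_mem_iterate_stepAB {j : ℕ} (hj : n ≤ j)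
    {s : Fin m × Set (Fin n) × Fin p} {q : Fin n}
    (hq : q ∈ ((stepAB hm hn hp f)^[j] s).2.1) : q.val = 0 := by
  have := val_eq_zero_or_lt_of_mem_iterate_stepAB j hq
  omega

theorem acceptsFrom_iterate_step_eq (x : Two) (j : ℕ) {s t : Fin m × Set (Fin n) × Fin p}
    (h : (zDFA m n p hm hn hp f).acceptsFrom s = (zDFA m n p hm hn hp f).acceptsFrom t) :
    (zDFA m n p hm hn hp f).acceptsFrom (((zDFA m n p hm hn hp f).step · x)^[j] s) =
      (zDFA m n p hm hn hp f).acceptsFrom (((zDFA m n p hm hn hp f).step · x)^[j] t) :=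
  DFA.acceptsFrom_iterate_eq (fun _ _ h => DFA.acceptsFrom_step_eq h x) j h

theorem acceptsFrom_iterate_stepAB_eq (j : ℕ) {s t : Fin m × Set (Fin n) × Fin p}
    (h : (zDFA m n p hm hn hp f).acceptsFrom s = (zDFA m n p hm hn hp f).acceptsFrom t) :
    (zDFA m n p hm hn hp f).acceptsFrom ((stepAB hm hn hp f)^[j] s) =
      (zDFA m n p hm hn hp f).acceptsFrom ((stepAB hm hn hp f)^[j] t) :=
  DFA.acceptsFrom_iterate_eq
    (fun _ _ h => DFA.acceptsFrom_step_eq (DFA.acceptsFrom_step_eq h _) _) j h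

theorem exists_nonempty_iterate_step_a (s : Fin m × Set (Fin n) × Fin p) :
    ∃ j, (((zDFA m n p hm hn hp f).step · Two.a)^[j] s).2.1.Nonempty := by
  obtain ⟨j, hj⟩ := exists_iterate_cyc_eq (cyc s.1) ⟨m - 1, by omega⟩
  refine ⟨j + 1, ⟨0, by omega⟩, ?_⟩
  have h1 : cyc (((zDFA m n p hm hn hp f).step · Two.a)^[j] s).1 = ⟨m - 1, by omega⟩ := by
    rw [← hj, ← Function.iterate_succ_apply, Function.iterate_succ_apply']
    exact congrArg cyc ((Function.Semiconj.iterate_right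
      (f := fun s : Fin m × Set (Fin n) × Fin p => s.1) (fun _ => rfl) j).eq s)
  rw [Function.iterate_succ_apply', zDFA_step_a]
  exact Or.inr ⟨congrArg Fin.val h1, rfl⟩

/-- Two states with nonempty sets of states of `ZB n` and different states of `ZC p` are
distinguishable as soon as powers of `ab` move the first of the latter to `p - 1`. -/
theorem acceptsFrom_ne_of_snd_snd_ne (hf : ∃ c, ¬(f c True ↔ f c False))
    {s t : Fin m × Set (Fin n) × Fin p} (hs : s.2.1.Nonempty) (ht : t.2.1.Nonempty)
    (hst : s.2.2 ≠ t.2.2) (hs1 : s.2.2.val ≠ 1) :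
    (zDFA m n p hm hn hp f).acceptsFrom s ≠ (zDFA m n p hm hn hp f).acceptsFrom t := by
  intro h
  have hinj : Function.Injective fun k : Fin p => cyc (transp k) :=
    cyc_injective.comp (transp_injective (by omega))
  obtain ⟨j, hj, hjs⟩ := exists_ge_iterate_eq hinj
    (exists_iterate_cyc_transp_eq hp hs1 (y := ⟨p - 1, by omega⟩) rfl) n
  have hjt := (hinj.iterate j).ne hst
  rw [hjs] at hjt
  rw [← iterate_stepAB_snd_snd (hm := hm) (hn := hn) (hp := hp) (f := f)] at hjs hjt
  have h := acceptsFrom_iterate_stepAB_eq j h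
  have hs0 := fun q => val_eq_zero_of_mem_iterate_stepAB (hm := hm) (hn := hn) (hp := hp)
    (f := f) hj (s := s) (q := q)
  have ht0 := fun q => val_eq_zero_of_mem_iterate_stepAB (hm := hm) (hn := hn) (hp := hp)
    (f := f) hj (s := t) (q := q)
  have hs := nonempty_iterate_stepAB (hm := hm) (hn := hn) (hp := hp) (f := f) hs j
  have ht := nonempty_iterate_stepAB (hm := hm) (hn := hn) (hp := hp) (f := f) ht j
  generalize (stepAB hm hn hp f)^[j] s = s at *
  generalize (stepAB hm hn hp f)^[j] t = t at *
  have hsp : s.2.2.val = p - 1 := congrArg Fin.val hjs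
  have htp : t.2.2.val ≠ p - 1 := fun h => hjt (Fin.ext h.symm)
  obtain ⟨c, hc⟩ := hf
  by_cases hcT : c
  · have h := DFA.mem_accept_iff_of_acceptsFrom_eq
      (acceptsFrom_iterate_step_eq Two.a (n - 1) h)
    have last {s : Fin m × Set (Fin n) × Fin p} (hs : s.2.1.Nonempty)
        (hs0 : ∀ q ∈ s.2.1, q.val = 0) :
        ∃ q ∈ (((zDFA m n p hm hn hp f).step · Two.a)^[n - 1] s).2.1, q.val = n - 1 := by
      obtain ⟨q, hq⟩ := hs
      have hq' : q = ⟨0, by omega⟩ := Fin.ext (hs0 q hq)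
      exact ⟨⟨n - 1, by omega⟩, (mem_zDFA_iterate_step_a (q := ⟨0, by omega⟩)
        (r := ⟨n - 1, by omega⟩) (Nat.zero_add _).symm s).2 (hq' ▸ hq), rfl⟩
    rw [mem_accept_zDFA, mem_accept_zDFA, zDFA_iterate_step_a_snd_snd,
      zDFA_iterate_step_a_snd_snd, val_transp_iterate_last hp, val_transp_iterate_last hp,
      eq_true hsp, eq_false htp, eq_true (last hs hs0), eq_true (last ht ht0)] at h
    rw [eq_true hcT] at hc
    exact hc h
  · have h := DFA.mem_accept_iff_of_acceptsFrom_eq h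
    have last {s : Fin m × Set (Fin n) × Fin p} (hs0 : ∀ q ∈ s.2.1, q.val = 0) :
        ¬∃ q ∈ s.2.1, q.val = n - 1 := by
      rintro ⟨q, hq, hqn⟩
      have := hs0 q hq
      omega
    rw [mem_accept_zDFA, mem_accept_zDFA, eq_true hsp, eq_false htp, eq_false (last hs0),
      eq_false (last ht0)] at h
    rw [eq_false hcT] at hc
    exact hc h

theorem snd_snd_eq_of_acceptsFrom_eq (hf : ∃ c, ¬(f c True ↔ f c False))
    {s t : Fin m × Set (Fin n) × Fin p}
    (h : (zDFA m n p hm hn hp f).acceptsFrom s = (zDFA m n p hm hn hp f).acceptsFrom t) :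
    s.2.2 = t.2.2 := by
  by_contra hst
  obtain ⟨i, hi⟩ := exists_nonempty_iterate_step_a (hm := hm) (hn := hn) (hp := hp) (f := f) s
  obtain ⟨j, hj⟩ := exists_nonempty_iterate_step_a (hm := hm) (hn := hn) (hp := hp) (f := f)
    (((zDFA m n p hm hn hp f).step · Two.a)^[i] t)
  have mono (j : ℕ) {s : Fin m × Set (Fin n) × Fin p} (hs : s.2.1.Nonempty) :
      (((zDFA m n p hm hn hp f).step · Two.a)^[j] s).2.1.Nonempty := by
    induction j with
    | zero => exact hs
    | succ j ih =>
      rw [Function.iterate_succ_apply']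
      exact nonempty_zDFA_step ih _
  have h := acceptsFrom_iterate_step_eq Two.a j (acceptsFrom_iterate_step_eq Two.a i h)
  have hne : (((zDFA m n p hm hn hp f).step · Two.a)^[j]
        (((zDFA m n p hm hn hp f).step · Two.a)^[i] s)).2.2 ≠
      (((zDFA m n p hm hn hp f).step · Two.a)^[j]
        (((zDFA m n p hm hn hp f).step · Two.a)^[i] t)).2.2 := by
    rw [zDFA_iterate_step_a_snd_snd, zDFA_iterate_step_a_snd_snd, zDFA_iterate_step_a_snd_snd,
      zDFA_iterate_step_a_snd_snd]
    have hinj := transp_injective (n := p) (by omega)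
    exact (hinj.iterate j).ne ((hinj.iterate i).ne hst)
  have hs := mono j hi
  generalize ((zDFA m n p hm hn hp f).step · Two.a)^[j]
    (((zDFA m n p hm hn hp f).step · Two.a)^[i] s) = s at *
  generalize ((zDFA m n p hm hn hp f).step · Two.a)^[j]
    (((zDFA m n p hm hn hp f).step · Two.a)^[i] t) = t at *
  by_cases hs1 : s.2.2.val = 1
  · have ht1 : t.2.2.val ≠ 1 := fun ht1 => hne (Fin.ext (hs1.trans ht1.symm))
    exact acceptsFrom_ne_of_snd_snd_ne hf hj hs hne.symm ht1 h.symm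
  · exact acceptsFrom_ne_of_snd_snd_ne hf hs hj hne hs1 h

theorem mem_iff_mem_of_acceptsFrom_eq (hf : ∃ d, ¬(f True d ↔ f False d))
    {s t : Fin m × Set (Fin n) × Fin p} (hst : s.2.2 = t.2.2)
    (h : (zDFA m n p hm hn hp f).acceptsFrom s = (zDFA m n p hm hn hp f).acceptsFrom t)
    (q : Fin n) : q ∈ s.2.1 ↔ q ∈ t.2.1 := by
  have large {s t : Fin m × Set (Fin n) × Fin p} (hst : s.2.2 = t.2.2)
      (h : (zDFA m n p hm hn hp f).acceptsFrom s = (zDFA m n p hm hn hp f).acceptsFrom t)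
      (q : Fin n) (hq : 2 ≤ q.val) : q ∈ s.2.1 ↔ q ∈ t.2.1 := by
    obtain ⟨d, hd⟩ := hf
    obtain ⟨j, hj⟩ : ∃ j, (cyc^[j] s.2.2).val = p - 1 ↔ d := by
      by_cases hdT : d
      · obtain ⟨j, hj⟩ := exists_iterate_cyc_eq s.2.2 ⟨p - 1, by omega⟩
        exact ⟨j, iff_of_true (by rw [hj]) hdT⟩
      · obtain ⟨j, hj⟩ := exists_iterate_cyc_eq s.2.2 ⟨0, by omega⟩
        exact ⟨j, iff_of_false (by rw [hj]; dsimp only; omega) hdT⟩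
    have h := DFA.mem_accept_iff_of_acceptsFrom_eq
      (acceptsFrom_iterate_step_eq Two.a (n - 1 - q.val)
        (acceptsFrom_iterate_step_eq Two.b j h))
    have hn1 : n - 1 < n := by omega
    have last (s : Fin m × Set (Fin n) × Fin p) :
        (∃ r ∈ (((zDFA m n p hm hn hp f).step · Two.a)^[n - 1 - q.val]
          (((zDFA m n p hm hn hp f).step · Two.b)^[j] s)).2.1, r.val = n - 1) ↔
        q ∈ s.2.1 := by
      rw [← mem_zDFA_iterate_step_b (hm := hm) (hn := hn) (hp := hp) (f := f) hq j s,
        ← mem_zDFA_iterate_step_a (hm := hm) (hn := hn) (hp := hp) (f := f) (q := q)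
          (r := ⟨n - 1, hn1⟩) (j := n - 1 - q.val) (by dsimp only; omega)]
      constructor
      · rintro ⟨r, hr, hrn⟩
        have hr' : r = ⟨n - 1, hn1⟩ := Fin.ext hrn
        exact hr' ▸ hr
      · exact fun h => ⟨_, h, rfl⟩
    rw [mem_accept_zDFA, mem_accept_zDFA, zDFA_iterate_step_a_snd_snd,
      zDFA_iterate_step_a_snd_snd, val_transp_iterate_last hp, val_transp_iterate_last hp,
      zDFA_iterate_step_b_snd_snd, zDFA_iterate_step_b_snd_snd, ← hst, propext hj,
      propext (last s), propext (last t)] at h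
    by_contra hne
    by_cases hs : q ∈ s.2.1 <;> by_cases ht : q ∈ t.2.1
    · exact hne (iff_of_true hs ht)
    · rw [eq_true hs, eq_false ht] at h
      exact hd h
    · rw [eq_false hs, eq_true ht] at h
      exact hd h.symm
    · exact hne (iff_of_false hs ht)
  have shift {s t : Fin m × Set (Fin n) × Fin p} (hst : s.2.2 = t.2.2) :
      ((zDFA m n p hm hn hp f).step s Two.a).2.2 =
        ((zDFA m n p hm hn hp f).step t Two.a).2.2 := by
    rw [zDFA_step_a, zDFA_step_a, hst]
  have one {s t : Fin m × Set (Fin n) × Fin p} (hst : s.2.2 = t.2.2)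
      (h : (zDFA m n p hm hn hp f).acceptsFrom s = (zDFA m n p hm hn hp f).acceptsFrom t)
      (q : Fin n) (hq : 1 ≤ q.val) : q ∈ s.2.1 ↔ q ∈ t.2.1 := by
    by_cases hq2 : 2 ≤ q.val
    · exact large hst h q hq2
    · have h2 := large (shift hst) (DFA.acceptsFrom_step_eq h Two.a) ⟨2, by omega⟩ le_rfl
      rwa [mem_zDFA_step_a (q := q) (by dsimp only; omega),
        mem_zDFA_step_a (q := q) (by dsimp only; omega)] at h2
  by_cases hq1 : 1 ≤ q.val
  · exact one hst h q hq1
  · have h1 := one (shift hst) (DFA.acceptsFrom_step_eq h Two.a) ⟨1, by omega⟩ le_rfl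
    rwa [mem_zDFA_step_a (q := q) (by dsimp only; omega),
      mem_zDFA_step_a (q := q) (by dsimp only; omega)] at h1

theorem fst_eq_of_acceptsFrom_eq (hf : ∃ d, ¬(f True d ↔ f False d))
    {s t : Fin m × Set (Fin n) × Fin p} (hst : s.2.2 = t.2.2)
    (h : (zDFA m n p hm hn hp f).acceptsFrom s = (zDFA m n p hm hn hp f).acceptsFrom t) :
    s.1 = t.1 := by
  wlog ht : t.1.val ≠ 0 generalizing s t
  · by_contra hne
    have hs : s.1.val ≠ 0 := fun hs => hne (Fin.ext (hs.trans (not_not.1 ht).symm))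
    exact hne (this hst.symm h.symm hs).symm
  by_contra hne
  have hinj : Function.Injective fun i : Fin m => transp (cyc i) :=
    (transp_injective (by omega)).comp cyc_injective
  obtain ⟨j, hj, hjt⟩ := exists_ge_iterate_eq hinj
    (exists_iterate_transp_cyc_eq hm ht (y := ⟨m - 2, by omega⟩) rfl) n
  have hjs := (hinj.iterate j).ne hne
  rw [hjt] at hjs
  rw [← iterate_stepAB_fst (hm := hm) (hn := hn) (hp := hp) (f := f)] at hjs hjt
  have hst' : ((stepAB hm hn hp f)^[j] s).2.2 = ((stepAB hm hn hp f)^[j] t).2.2 := by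
    rw [iterate_stepAB_snd_snd, iterate_stepAB_snd_snd, hst]
  have h := acceptsFrom_iterate_stepAB_eq j h
  have hs0 := fun q => val_eq_zero_of_mem_iterate_stepAB (hm := hm) (hn := hn) (hp := hp)
    (f := f) hj (s := s) (q := q)
  generalize (stepAB hm hn hp f)^[j] s = s at *
  generalize (stepAB hm hn hp f)^[j] t = t at *
  have hmem := mem_iff_mem_of_acceptsFrom_eq hf
    (by rw [zDFA_step_a, zDFA_step_a, hst']) (DFA.acceptsFrom_step_eq h Two.a) ⟨0, by omega⟩
  rw [zDFA_step_a, zDFA_step_a] at hmem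
  have hlast : cyc (⟨m - 2, by omega⟩ : Fin m) = ⟨m - 1, by omega⟩ := by
    ext
    rw [val_cyc, if_neg (by dsimp only; omega)]
    dsimp only
    omega
  rcases hmem.2 (Or.inr ⟨by rw [hjt, hlast], rfl⟩) with ⟨r, hr, hr0⟩ | ⟨hc, -⟩
  · have hr0 := congrArg Fin.val hr0
    rw [val_cyc, hs0 r hr, if_neg (by omega)] at hr0
    exact one_ne_zero hr0
  · refine hjs (cyc_injective (Fin.ext ?_))
    rw [hlast, hc]

theorem eq_of_acceptsFrom_eq (hf₁ : ∃ c, ¬(f c True ↔ f c False))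
    (hf₂ : ∃ d, ¬(f True d ↔ f False d)) {s t : Fin m × Set (Fin n) × Fin p}
    (h : (zDFA m n p hm hn hp f).acceptsFrom s = (zDFA m n p hm hn hp f).acceptsFrom t) :
    s = t := by
  have hst := snd_snd_eq_of_acceptsFrom_eq hf₁ h
  exact Prod.ext (fst_eq_of_acceptsFrom_eq hf₂ hst h)
    (Prod.ext (Set.ext (mem_iff_mem_of_acceptsFrom_eq hf₂ hst h)) hst)

end ZDFA

theorem ncard_setOf_mem {ι : Type*} [Finite ι] (x : ι) :
    {S : Set ι | x ∈ S}.ncard = 2 ^ (Nat.card ι - 1) := by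
  have h : {S : Set ι | x ∈ S} = compl '' 𝒫 {x}ᶜ := by
    ext S
    constructor
    · intro h
      refine ⟨Sᶜ, ?_, compl_compl S⟩
      exact Set.compl_subset_compl.2 (Set.singleton_subset_iff.2 h)
    · rintro ⟨T, hT, rfl⟩
      exact fun hx => hT hx rfl
  rw [h, Set.ncard_image_of_injective _ compl_injective, Set.ncard_powerset, Set.ncard_compl,
    Set.ncard_singleton]

theorem ncard_setOf_imp_mem {ι κ τ : Type*} [Finite ι] [Finite κ] [Finite τ] (i : ι) (x : κ) :
    {s : ι × Set κ × τ | s.1 = i → x ∈ s.2.1}.ncard =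
      ((Nat.card ι - 1) * 2 ^ Nat.card κ + 2 ^ (Nat.card κ - 1)) * Nat.card τ := by
  have h : {s : ι × Set κ × τ | s.1 = i → x ∈ s.2.1} =
      ({i}ᶜ ×ˢ Set.univ) ∪ ({i} ×ˢ ({S | x ∈ S} ×ˢ Set.univ)) := by
    ext s
    by_cases hs : s.1 = i <;> simp [hs]
  have hdisj : Disjoint (({i} : Set ι)ᶜ ×ˢ (Set.univ : Set (Set κ × τ)))
      (({i} : Set ι) ×ˢ ({S : Set κ | x ∈ S} ×ˢ Set.univ)) :=
    Set.disjoint_prod.2 (Or.inl disjoint_compl_left)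
  have hpow : Nat.card (Set κ) = 2 ^ Nat.card κ := by
    rw [← Set.ncard_univ, ← Set.powerset_univ, Set.ncard_powerset, Set.ncard_univ]
  rw [h, Set.ncard_union_eq hdisj, Set.ncard_prod, Set.ncard_prod, Set.ncard_prod,
    Set.ncard_compl, Set.ncard_singleton, Set.ncard_univ, Set.ncard_univ, Nat.card_prod,
    ncard_setOf_mem, hpow]
  ring

theorem sc_zDFA {m n p : ℕ} (hm : 2 < m) (hn : 2 < n) (hp : 2 < p)
    {f : Prop → Prop → Prop} (hf₁ : ∃ c, ¬(f c True ↔ f c False))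
    (hf₂ : ∃ d, ¬(f True d ↔ f False d)) :
    sc (zDFA m n p hm hn hp f).accepts = ((m - 1) * 2 ^ n + 2 ^ (n - 1)) * p := by
  rw [sc_accepts_eq_ncard _
    {s : Fin m × Set (Fin n) × Fin p | s.1 = ⟨m - 1, by omega⟩ → ⟨0, by omega⟩ ∈ s.2.1}
    (fun s => ?_) (fun s t => eq_of_acceptsFrom_eq hf₁ hf₂), ncard_setOf_imp_mem,
    Nat.card_fin, Nat.card_fin, Nat.card_fin]
  rw [exists_eval_zDFA_eq_iff, Set.mem_ofPred_eq, Fin.ext_iff]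

theorem statement16 (m n p : ℕ) (hm : 3 ≤ m) (hn : 3 ≤ n) (hp : 3 ≤ p)
    (op : Language Two → Language Two → Language Two)
    (hop : op = (· ⊔ ·) ∨ op = (· ⊓ ·) ∨ op = symmDiff) :
    sc (op ((ZA m (by omega)).accepts * (ZB n (by omega)).accepts) (ZC p (by omega)).accepts) =
      ((m - 1) * 2 ^ n + 2 ^ (n - 1)) * p := by
  have key (f : Prop → Prop → Prop) (hf₁ : ∃ c, ¬(f c True ↔ f c False))
      (hf₂ : ∃ d, ¬(f True d ↔ f False d))
      (hop : ∀ (K L : Language Two) w, w ∈ op K L ↔ f (w ∈ K) (w ∈ L)) :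
      sc (op ((ZA m (by omega)).accepts * (ZB n (by omega)).accepts)
        (ZC p (by omega)).accepts) = ((m - 1) * 2 ^ n + 2 ^ (n - 1)) * p := by
    rw [← sc_zDFA hm hn hp hf₁ hf₂]
    congr 1
    ext w
    rw [hop]
    exact (mem_accepts_catBoolDFA _ _ _ f w).symm
  rcases hop with rfl | rfl | rfl
  · exact key Or ⟨False, by simp⟩ ⟨False, by simp⟩ fun K L w => Iff.rfl
  · exact key And ⟨True, by simp⟩ ⟨True, by simp⟩ fun K L w => Iff.rfl
  · exact key Xor ⟨False, by simp [Xor]⟩ ⟨False, by simp [Xor]⟩ fun K L w => Iff.rfl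
end

section
/- Let m,n ≥ 3 and let D be the catenation DFA X_m(a,b,−;∅)·X_n(a,−,b;∅) over alphabet {a,b}, whose states are pairs (i,S) with 0 ≤ i ≤ m−1 and S ⊆ {0,…,n−1}, a state being final iff n−1 ∈ S. Then for every state (i,S) satisfying the condition (i = m−1 implies 0 ∈ S), there exists a word u ∈ {a,b}* such that (i,S)·u is final, and there exists a word v ∈ {a,b}* such that (i,S)·v is not final. -/
theorem mem_catDFA_step {α σA σM : Type} (A : DFA α σA) (M : DFA α σM) (q : σA × Set σM)
    (x : α) (s : σM) :
    s ∈ ((catDFA A M).step q x).2 ↔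
      (∃ t ∈ q.2, M.step t x = s) ∨ (A.step q.1 x ∈ A.accept ∧ s = M.start) := by
  simp only [catDFA]
  split_ifs with h <;> simp [h, or_comm]

theorem mem_catDFA_accept_ZB {σA : Type} {n : ℕ} (hn : 0 < n) (A : DFA Two σA)
    (q : σA × Set (Fin n)) :
    q ∈ (catDFA A (ZB n hn)).accept ↔ (⟨n - 1, Nat.sub_lt hn Nat.one_pos⟩ : Fin n) ∈ q.2 := by
  simp [catDFA, ZB, brzDFA]

theorem cyc_eq_of_lt {n : ℕ} (s : Fin n) (h : s.val + 1 < n) : cyc s = ⟨s.val + 1, h⟩ := by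
  simp [cyc, Nat.mod_eq_of_lt h]

/-- A state whose second component is nonempty leads to acceptance by reading only `a`. -/
theorem exists_accepting_word_of_mem {σA : Type} {n : ℕ} (hn : 0 < n) (A : DFA Two σA) (k : ℕ)
    (q : σA × Set (Fin n)) (s : Fin n) (hs : s ∈ q.2) (hk : s.val + k = n - 1) :
    ∃ u, (catDFA A (ZB n hn)).evalFrom q u ∈ (catDFA A (ZB n hn)).accept := by
  induction k generalizing q s with
  | zero =>
    refine ⟨[], (mem_catDFA_accept_ZB hn A q).2 ?_⟩
    rwa [show (⟨n - 1, Nat.sub_lt hn Nat.one_pos⟩ : Fin n) = s from Fin.ext (by simp; omega)]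
  | succ k ih =>
    have hlt : s.val + 1 < n := by omega
    obtain ⟨u, hu⟩ := ih ((catDFA A (ZB n hn)).step q Two.a) ⟨s.val + 1, hlt⟩
      ((mem_catDFA_step _ _ _ _ _).2 (Or.inl ⟨s, hs, cyc_eq_of_lt s hlt⟩))
      (by simp only; omega)
    exact ⟨Two.a :: u, hu⟩

/-- A nonzero element missing from the second component can be shifted to the final state
by reading only `a`. -/
theorem exists_rejecting_word_of_notMem {σA : Type} {n : ℕ} (hn : 0 < n) (A : DFA Two σA) (k : ℕ)
    (q : σA × Set (Fin n)) (s : Fin n) (h0 : 0 < s.val) (hs : s ∉ q.2) (hk : s.val + k = n - 1) :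
    ∃ v, (catDFA A (ZB n hn)).evalFrom q v ∉ (catDFA A (ZB n hn)).accept := by
  induction k generalizing q s with
  | zero =>
    refine ⟨[], fun h => hs ?_⟩
    have := (mem_catDFA_accept_ZB hn A q).1 h
    rwa [show (⟨n - 1, Nat.sub_lt hn Nat.one_pos⟩ : Fin n) = s from Fin.ext (by simp; omega)]
      at this
  | succ k ih =>
    have hlt : s.val + 1 < n := by omega
    have hs' : ⟨s.val + 1, hlt⟩ ∉ ((catDFA A (ZB n hn)).step q Two.a).2 := by
      intro h
      rcases (mem_catDFA_step _ _ _ _ _).1 h with ⟨t, ht, hts⟩ | ⟨-, h⟩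
      · have hmod : (t.val + 1) % n = s.val + 1 := congrArg Fin.val hts
        have htn : t.val + 1 < n := by
          by_contra hge
          rw [show t.val + 1 = n by omega, Nat.mod_self] at hmod
          omega
        rw [Nat.mod_eq_of_lt htn] at hmod
        exact hs ((Fin.ext (by omega) : t = s) ▸ ht)
      · simpa [ZB, brzDFA] using congrArg Fin.val h
    obtain ⟨v, hv⟩ := ih _ ⟨s.val + 1, hlt⟩ (Nat.succ_pos _) hs' (by simp only; omega)
    exact ⟨Two.a :: v, hv⟩

theorem one_notMem_catDFA_step_b {σA : Type} {n : ℕ} (hn : 1 < n) (A : DFA Two σA)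
    (q : σA × Set (Fin n)) :
    (⟨1, hn⟩ : Fin n) ∉ ((catDFA A (ZB n (Nat.zero_lt_of_lt hn))).step q Two.b).2 := by
  intro h
  rcases (mem_catDFA_step _ _ _ _ _).1 h with ⟨t, -, ht⟩ | ⟨-, h⟩
  · have ht' : contr t = ⟨1, hn⟩ := ht
    unfold contr at ht'
    split_ifs at ht' with h1
    · simp at ht'
    · exact h1 (congrArg Fin.val ht')
  · simpa [ZB, brzDFA] using congrArg Fin.val h

theorem exists_accepting_word {m n : ℕ} (hm : 0 < m) (hn : 0 < n) (k : ℕ)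
    (q : Fin m × Set (Fin n)) (hq : q.1.val = m - 1 → (⟨0, hn⟩ : Fin n) ∈ q.2)
    (hk : q.1.val + k = m - 1) :
    ∃ u, (catDFA (ZA m hm) (ZB n hn)).evalFrom q u ∈ (catDFA (ZA m hm) (ZB n hn)).accept := by
  induction k generalizing q with
  | zero =>
    exact exists_accepting_word_of_mem hn _ (n - 1) q _ (hq (by omega)) (by simp)
  | succ k ih =>
    have hlt : q.1.val + 1 < m := by omega
    have hfst : ((catDFA (ZA m hm) (ZB n hn)).step q Two.a).1 = ⟨q.1.val + 1, hlt⟩ :=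
      cyc_eq_of_lt q.1 hlt
    obtain ⟨u, hu⟩ := ih ((catDFA (ZA m hm) (ZB n hn)).step q Two.a)
      (fun h => (mem_catDFA_step _ _ _ _ _).2 (Or.inr ⟨Set.mem_singleton_iff.2 (Fin.ext h), rfl⟩))
      (by rw [hfst]; simp only; omega)
    exact ⟨Two.a :: u, hu⟩

theorem statement19 (m n : ℕ) (hm : 3 ≤ m) (hn : 3 ≤ n)
    (i : Fin m) (S : Set (Fin n)) (hS : i.val = m - 1 → (⟨0, by omega⟩ : Fin n) ∈ S) :
    (∃ u : List Two,
        (catDFA (ZA m (by omega)) (ZB n (by omega))).evalFrom (i, S) u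
          ∈ (catDFA (ZA m (by omega)) (ZB n (by omega))).accept) ∧
    (∃ v : List Two,
        (catDFA (ZA m (by omega)) (ZB n (by omega))).evalFrom (i, S) v
          ∉ (catDFA (ZA m (by omega)) (ZB n (by omega))).accept) := by
  refine ⟨exists_accepting_word _ _ (m - 1 - i.val) (i, S) hS (by simp only; omega), ?_⟩
  obtain ⟨v, hv⟩ := exists_rejecting_word_of_notMem (n := n) (by omega) (ZA m (by omega)) (n - 2) _
    ⟨1, by omega⟩ Nat.one_pos (one_notMem_catDFA_step_b (by omega) (ZA m (by omega)) (i, S))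
    (by simp only; omega)
  exact ⟨Two.b :: v, hv⟩
end
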